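/- (Fundamental quasisymmetric expansion of Macdonald cumulants.) Let λ^1,…,λ^r be partitions with n = |λ^{[r]}| and let N ≥ 1. Then, in ℤ[q,t,x_1,…,x_N], Σ_{π ∈ 𝒫([r])} (−1)^{#π−1}(#π−1)! Π_{B∈π} H̃_{λ^B}^{(N)} = (q−1)^{r−1} · Σ_σ 𝓘_{G^σ}(q) · t^{maj(σ)} · F_{n, iDes(w_σ)}(x_1,…,x_N), where the sum runs over all standard fillings σ of λ^{[r]} (bijections σ : λ^{[r]} → {1,…,n}). -/

import Mathlib

open Finset

open scoped Classical

noncomputable section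

/-! ### Set partitions -/

/-- `π` is a set partition of the finite set `H`. -/
def IsSetPartition {α : Type*} (π : Finset (Finset α)) (H : Finset α) : Prop :=
  (∀ B ∈ π, B ⊆ H) ∧ (∀ B ∈ π, B.Nonempty) ∧
    (∀ B ∈ π, ∀ C ∈ π, B ≠ C → Disjoint B C) ∧ (∀ a ∈ H, ∃ B ∈ π, a ∈ B)

/-- The finite set of all set partitions of `H`. -/
def setPartitions {α : Type*} (H : Finset α) : Finset (Finset (Finset α)) :=
  H.powerset.powerset.filter (fun π => IsSetPartition π H)

/-- The joint cumulant of the family `u` on the subset `H`. -/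
def jointCumulant {A : Type*} [CommRing A] {ι : Type*} (u : Finset ι → A) (H : Finset ι) : A :=
  ∑ π ∈ setPartitions H,
    (-1 : A) ^ (π.card - 1) * ((π.card - 1).factorial : A) * ∏ B ∈ π, u B

/-! ### Multigraphs -/

/-- Number of edges of the multigraph with endpoint map `ends` whose endpoint set is `{i,j}`. -/
def eCnt {V E : Type*} [Fintype E] (ends : E → Sym2 V) (i j : V) : ℕ :=
  (univ.filter fun e => ends e = s(i, j)).card

/-- The spanning subgraph `(V, S)` is connected. -/
def SConnected {V E : Type*} (ends : E → Sym2 V) (S : Finset E) : Prop :=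
  ∀ v w : V, Relation.ReflTransGen (fun a b => ∃ e ∈ S, ends e = s(a, b)) v w

/-- The subgraph `(B, S)` is connected. -/
def SConnectedOn {V E : Type*} (ends : E → Sym2 V) (B : Finset V) (S : Finset E) : Prop :=
  ∀ v ∈ B, ∀ w ∈ B, Relation.ReflTransGen (fun a b => ∃ e ∈ S, ends e = s(a, b)) v w

/-- `E|_B`: the edges with both endpoints in `B`. -/
def edgesIn {V E : Type*} [Fintype E] (ends : E → Sym2 V) (B : Finset V) : Finset E :=
  univ.filter fun e => ∀ v ∈ ends e, v ∈ B

/-- `c_{G|_B}(q) = Σ_{S ⊆ E|_B, (B,S) connected} q^{#S}` as a polynomial in `q`. -/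
def connPoly {V E : Type*} [Fintype E] (ends : E → Sym2 V) (B : Finset V) : Polynomial ℤ :=
  ∑ S ∈ (edgesIn ends B).powerset.filter (fun S => SConnectedOn ends B S),
    Polynomial.X ^ S.card

/-- Number of edges joining `w` to some vertex of `B`. -/
def dCnt {V E : Type*} [Fintype E] (ends : E → Sym2 V) (B : Finset V) (w : V) : ℕ :=
  (univ.filter fun e => ∃ b ∈ B, ends e = s(w, b)).card

/-! ### The `G`-inversion polynomial -/

/-- `[m]_q = 1 + q + ⋯ + q^{m-1}`. -/
def nq {R : Type*} [CommSemiring R] (q : R) (m : ℕ) : R := ∑ k ∈ Finset.range m, q ^ k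

/-- Rooted spanning trees (encoded by parent maps, rooted at `0`) of the simple graph `G̃`
underlying the multigraph on `Fin (r+1)` with edge multiplicities `e`. -/
def parentMaps {r : ℕ} (e : Fin (r+1) → Fin (r+1) → ℕ) : Finset (Fin (r+1) → Fin (r+1)) :=
  univ.filter fun p => p 0 = 0 ∧ (∀ w, w ≠ 0 → p w ≠ w ∧ 0 < e w (p w)) ∧ ∀ w, ∃ k, p^[k] w = 0

/-- `(i,j)` is a `κ`-inversion of the spanning tree encoded by `p`. -/
def isKappaInv {r : ℕ} (e : Fin (r+1) → Fin (r+1) → ℕ) (p : Fin (r+1) → Fin (r+1))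
    (i j : Fin (r+1)) : Prop :=
  i ≠ 0 ∧ j ≠ 0 ∧ i ≠ j ∧ (∃ k, p^[k] j = i) ∧ j < i ∧ p i ≠ j ∧ 0 < e j (p i)

/-- `κ(T) = Σ_{(i,j) κ-inversion} e_{parent(i), j}`. -/
def kappaStat {r : ℕ} (e : Fin (r+1) → Fin (r+1) → ℕ) (p : Fin (r+1) → Fin (r+1)) : ℕ :=
  ∑ pr ∈ (univ ×ˢ univ : Finset (Fin (r+1) × Fin (r+1))).filter
    (fun pr => isKappaInv e p pr.1 pr.2), e (p pr.1) pr.2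

/-- `δ_T(w) = Σ_u e_{u, parent(w)}`, `u` ranging over descendants of `w` together with `w`. -/
def deltaStat {r : ℕ} (e : Fin (r+1) → Fin (r+1) → ℕ) (p : Fin (r+1) → Fin (r+1))
    (w : Fin (r+1)) : ℕ :=
  ∑ u ∈ univ.filter (fun u => ∃ k, p^[k] u = w), e u (p w)

/-- The `G`-inversion polynomial `𝓘_G(q)` of the multigraph on `Fin (r+1)` with
edge multiplicities `e`, evaluated at an element `q` of a commutative (semi)ring. -/
def Iinv {r : ℕ} {R : Type*} [CommSemiring R] (e : Fin (r+1) → Fin (r+1) → ℕ) (q : R) : R :=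
  q ^ (∑ i, e i i) *
    ∑ p ∈ parentMaps e, q ^ kappaStat e p * ∏ w ∈ univ.erase (0 : Fin (r+1)), nq q (e w (p w))

/-! ### Partitions, Young diagrams and fillings -/

/-- `f : ℕ → ℕ` encodes a partition: `f j` is the `j`-th part (for `j ≥ 1`). -/
def IsPartitionFun (f : ℕ → ℕ) : Prop := Antitone f ∧ ∃ N, f N = 0

/-- The number of (nonempty) rows of the diagram of `f`. -/
def nRows (f : ℕ → ℕ) : ℕ := sSup {j | f j ≠ 0}

/-- `λ^t_i`: the length of the `i`-th column of the diagram of `f`. -/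
def colLen (f : ℕ → ℕ) (i : ℕ) : ℕ :=
  ((Finset.Icc 1 (nRows f)).filter (fun j => i ≤ f j)).card

/-- The cells `(i,j)`, `1 ≤ i ≤ f j`, `j ≥ 1`, of the Young diagram of `f`
(French convention, `i` the column index and `j` the row index). -/
def cells (f : ℕ → ℕ) : Finset (ℕ × ℕ) :=
  (Finset.Icc 1 (f 1) ×ˢ Finset.Icc 1 (nRows f)).filter (fun c => c.1 ≤ f c.2)

/-- Fillings of the diagram of `f` with entries in `{1, …, N}`, encoded as functions
`ℕ × ℕ → ℕ` vanishing outside the diagram. -/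
def fillings (f : ℕ → ℕ) (N : ℕ) : Finset ((ℕ × ℕ) → ℕ) :=
  ((cells f).pi (fun _ => Finset.Icc 1 N)).image
    (fun g c => if h : c ∈ cells f then g c h else 0)

/-- The descent set of a filling. -/
def desSet (f : ℕ → ℕ) (σ : (ℕ × ℕ) → ℕ) : Finset (ℕ × ℕ) :=
  (cells f).filter (fun c => 2 ≤ c.2 ∧ σ (c.1, c.2 - 1) < σ c)

/-- `maj(σ) = Σ_{□ ∈ Des(σ)} (leg(□) + 1)`. -/
def majStat (f : ℕ → ℕ) (σ : (ℕ × ℕ) → ℕ) : ℕ :=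
  ∑ c ∈ desSet f σ, (colLen f c.1 - c.2 + 1)

/-- The counterclockwise-increasing condition defining inversion pairs; the box below `c1`
is read via `σ`, which vanishes off the diagram (giving the convention `σ(□_3) = 0`). -/
def invTriple (σ : (ℕ × ℕ) → ℕ) (c1 c2 : ℕ × ℕ) : Prop :=
  (σ c1 ≤ σ (c1.1, c1.2 - 1) ∧ σ (c1.1, c1.2 - 1) < σ c2) ∨
  (σ (c1.1, c1.2 - 1) < σ c2 ∧ σ c2 < σ c1) ∨
  (σ c2 < σ c1 ∧ σ c1 ≤ σ (c1.1, c1.2 - 1))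

/-- The set of inversion pairs of a filling. -/
def invPairs (f : ℕ → ℕ) (σ : (ℕ × ℕ) → ℕ) : Finset ((ℕ × ℕ) × (ℕ × ℕ)) :=
  ((cells f) ×ˢ (cells f)).filter
    (fun pr => pr.1.2 = pr.2.2 ∧ pr.1.1 < pr.2.1 ∧ invTriple σ pr.1 pr.2)

/-- `inv(σ)`: the number of inversion pairs. -/
def invStat (f : ℕ → ℕ) (σ : (ℕ × ℕ) → ℕ) : ℕ := (invPairs f σ).card

/-! ### The ring `ℤ[q, t, x₁, x₂, …]` and Macdonald polynomials -/

/-- The polynomial ring `ℤ[q, t, x₀, x₁, x₂, …]`. -/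
abbrev MR : Type := MvPolynomial (Fin 2 ⊕ ℕ) ℤ

/-- The variable `q`. -/
def qv : MR := MvPolynomial.X (Sum.inl 0)

/-- The variable `t`. -/
def tv : MR := MvPolynomial.X (Sum.inl 1)

/-- The variable `x_k`. -/
def xv (k : ℕ) : MR := MvPolynomial.X (Sum.inr k)

/-- Haglund's formula: the modified Macdonald polynomial in the variables `x_1, …, x_N`. -/
def macH (f : ℕ → ℕ) (N : ℕ) : MR :=
  ∑ σ ∈ fillings f N, qv ^ invStat f σ * tv ^ majStat f σ * ∏ c ∈ cells f, xv (σ c)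

/-- `λ^B = ⊕_{b ∈ B} λ^b`. -/
def lamB {r : ℕ} (lam : Fin (r+1) → ℕ → ℕ) (B : Finset (Fin (r+1))) : ℕ → ℕ :=
  fun j => ∑ b ∈ B, lam b j

/-- The (unnormalized) Macdonald cumulant
`Σ_{π ∈ 𝒫([r])} (-1)^{#π-1} (#π-1)! Π_{B ∈ π} H̃_{λ^B}`. -/
def macCumulant {r : ℕ} (lam : Fin (r+1) → ℕ → ℕ) (N : ℕ) : MR :=
  ∑ π ∈ setPartitions (univ : Finset (Fin (r+1))),
    (-1 : MR) ^ (π.card - 1) * ((π.card - 1).factorial : MR) * ∏ B ∈ π, macH (lamB lam B) N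

/-! ### Coloring of the diagram `λ^B` -/

/-- Labels `(b, i)`, `b ∈ B`, `1 ≤ i ≤ λ^b_1`, of the columns of the diagrams `λ^b`, `b ∈ B`. -/
def columnPairs {r : ℕ} (lam : Fin (r+1) → ℕ → ℕ) (B : Finset (Fin (r+1))) :
    Finset (Fin (r+1) × ℕ) :=
  (B ×ˢ Finset.Icc 1 (lamB lam B 1)).filter (fun p => p.2 ≤ lam p.1 1)

/-- The column `p'` comes weakly before the column `p` in the sorted order
(longer first; ties first by color, then by column index). -/
def colBefore {r : ℕ} (lam : Fin (r+1) → ℕ → ℕ) (p' p : Fin (r+1) × ℕ) : Prop :=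
  colLen (lam p.1) p.2 < colLen (lam p'.1) p'.2 ∨
    (colLen (lam p'.1) p'.2 = colLen (lam p.1) p.2 ∧
      (p'.1 < p.1 ∨ (p'.1 = p.1 ∧ p'.2 ≤ p.2)))

/-- The position in `λ^B` of the column `i` of `λ^b`. -/
def posIn {r : ℕ} (lam : Fin (r+1) → ℕ → ℕ) (B : Finset (Fin (r+1)))
    (b : Fin (r+1)) (i : ℕ) : ℕ :=
  ((columnPairs lam B).filter (fun p' => colBefore lam p' (b, i))).card

/-- The label `(b, i)` of the column of `λ^B` at position `c`. -/
def colAt {r : ℕ} (lam : Fin (r+1) → ℕ → ℕ) (B : Finset (Fin (r+1))) (c : ℕ) :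
    Fin (r+1) × ℕ :=
  if h : ∃ p ∈ columnPairs lam B, posIn lam B p.1 p.2 = c then h.choose else (0, 1)

/-- The filling `σ^B` of `λ^B` induced from a filling `σ` of `λ^{[r]}` via the
identification of boxes given by the coloring. -/
def inducedFilling {r : ℕ} (lam : Fin (r+1) → ℕ → ℕ) (B : Finset (Fin (r+1)))
    (σ : (ℕ × ℕ) → ℕ) : (ℕ × ℕ) → ℕ :=
  fun cj =>
    if ∃ p ∈ columnPairs lam B, posIn lam B p.1 p.2 = cj.1 then
      σ (posIn lam univ (colAt lam B cj.1).1 (colAt lam B cj.1).2, cj.2)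
    else 0

/-- The color of the column `x` of `λ^{[r]}`. -/
def colColor {r : ℕ} (lam : Fin (r+1) → ℕ → ℕ) (x : ℕ) : Fin (r+1) :=
  (colAt lam univ x).1

/-- Edge multiplicities of the multigraph `G^σ`: the number of inversion pairs of `σ`
colored by `{i, j}`. -/
def eG {r : ℕ} (lam : Fin (r+1) → ℕ → ℕ) (σ : (ℕ × ℕ) → ℕ) (i j : Fin (r+1)) : ℕ :=
  ((invPairs (lamB lam univ) σ).filter (fun pr =>
    (colColor lam pr.1.1 = i ∧ colColor lam pr.2.1 = j) ∨
    (colColor lam pr.1.1 = j ∧ colColor lam pr.2.1 = i))).card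

/-- Edge multiplicities of the multigraph `G^{□_1,…,□_s}` attached to a set `D` of boxes:
for each box of `D` and each box strictly to its left in the same row, one edge joining
the colors of the two columns. -/
def eBox {r : ℕ} (lam : Fin (r+1) → ℕ → ℕ) (D : Finset (ℕ × ℕ)) (i j : Fin (r+1)) : ℕ :=
  ((D ×ˢ cells (lamB lam univ)).filter (fun pr =>
    pr.2.2 = pr.1.2 ∧ pr.2.1 < pr.1.1 ∧
      ((colColor lam pr.2.1 = i ∧ colColor lam pr.1.1 = j) ∨
       (colColor lam pr.2.1 = j ∧ colColor lam pr.1.1 = i)))).card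


/-- Standard fillings: bijective fillings by `{1, …, n}`, `n` the number of boxes. -/
def standardFillings (f : ℕ → ℕ) : Finset ((ℕ × ℕ) → ℕ) :=
  (fillings f (cells f).card).filter (fun σ => Set.InjOn σ (cells f))

/-- The inverse-descent set of (the reading word of) a standard filling: those `k` such
that `k+1` precedes `k` in the reading order (rows top to bottom, left to right). -/
def iDesSet (f : ℕ → ℕ) (σ : (ℕ × ℕ) → ℕ) : Finset ℕ :=
  (Finset.Icc 1 ((cells f).card - 1)).filter (fun k =>
    ∃ c ∈ cells f, ∃ c' ∈ cells f, σ c = k + 1 ∧ σ c' = k ∧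
      (c'.2 < c.2 ∨ (c.2 = c'.2 ∧ c.1 < c'.1)))

/-- The fundamental quasisymmetric polynomial `F_{n,D}(x_1, …, x_N)`. -/
def Fqs (n N : ℕ) (D : Finset ℕ) : MR :=
  ∑ g ∈ (univ : Finset (Fin n → Fin N)).filter (fun g => Monotone g ∧
      ∀ a b : Fin n, (b : ℕ) = (a : ℕ) + 1 → (b : ℕ) ∈ D → g a < g b),
    ∏ a : Fin n, xv ((g a : ℕ) + 1)

/-! ### Cumulants and moments -/

theorem mem_setPartitions {α : Type*} {π : Finset (Finset α)} {H : Finset α} :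
    π ∈ setPartitions H ↔ IsSetPartition π H := by
  simp only [setPartitions, mem_filter, mem_powerset, and_iff_right_iff_imp]
  intro h B hB
  exact mem_powerset.2 (h.1 B hB)

theorem IsSetPartition.insert_sdiff {α : Type*} [DecidableEq α]
    {π : Finset (Finset α)} {H A : Finset α}
    (h : IsSetPartition π A) (hA : A ⊂ H) : IsSetPartition (insert (H \ A) π) H := by
  obtain ⟨h1, h2, h3, h4⟩ := h
  refine ⟨?_, ?_, ?_, ?_⟩
  · intro B hB
    rcases mem_insert.1 hB with rfl | hB
    · exact sdiff_subset
    · exact (h1 B hB).trans hA.1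
  · intro B hB
    rcases mem_insert.1 hB with rfl | hB
    · exact sdiff_nonempty.2 hA.2
    · exact h2 B hB
  · intro B hB C hC hne
    rcases mem_insert.1 hB with rfl | hB <;> rcases mem_insert.1 hC with rfl | hC
    · exact absurd rfl hne
    · exact disjoint_of_subset_right (h1 C hC) sdiff_disjoint
    · exact disjoint_of_subset_left (h1 B hB) disjoint_sdiff
    · exact h3 B hB C hC hne
  · intro a ha
    by_cases haA : a ∈ A
    · obtain ⟨B, hB, haB⟩ := h4 a haA
      exact ⟨B, mem_insert_of_mem hB, haB⟩
    · exact ⟨H \ A, mem_insert_self _ _, mem_sdiff.2 ⟨ha, haA⟩⟩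

theorem IsSetPartition.erase_block {α : Type*} [DecidableEq α]
    {π : Finset (Finset α)} {H C : Finset α}
    (h : IsSetPartition π H) (hC : C ∈ π) : IsSetPartition (π.erase C) (H \ C) := by
  obtain ⟨h1, h2, h3, h4⟩ := h
  refine ⟨?_, ?_, ?_, ?_⟩
  · intro B hB
    obtain ⟨hne, hB⟩ := mem_erase.1 hB
    exact subset_sdiff.2 ⟨h1 B hB, h3 B hB C hC hne⟩
  · intro B hB
    exact h2 B (mem_of_mem_erase hB)
  · intro B hB D hD hne
    exact h3 B (mem_of_mem_erase hB) D (mem_of_mem_erase hD) hne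
  · intro a ha
    obtain ⟨ha, haC⟩ := mem_sdiff.1 ha
    obtain ⟨B, hB, haB⟩ := h4 a ha
    refine ⟨B, mem_erase.2 ⟨?_, hB⟩, haB⟩
    rintro rfl
    exact haC haB

theorem IsSetPartition.card_blocks_notMem {α : Type*} [DecidableEq α]
    {π : Finset (Finset α)} {H : Finset α}
    (h : IsSetPartition π H) {v : α} (hv : v ∈ H) :
    (π.filter fun C => v ∉ C).card = π.card - 1 := by
  obtain ⟨h1, h2, h3, h4⟩ := h
  obtain ⟨B, hB, hvB⟩ := h4 v hv
  rw [← card_erase_of_mem hB]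
  congr 1
  ext C
  simp only [mem_filter, mem_erase]
  constructor
  · rintro ⟨hC, hvC⟩
    exact ⟨fun h => hvC (h ▸ hvB), hC⟩
  · rintro ⟨hne, hC⟩
    exact ⟨hC, fun hvC => disjoint_left.1 (h3 C hC B hB hne) hvC hvB⟩

theorem IsSetPartition.eq_singleton {α : Type*} {π : Finset (Finset α)} {H : Finset α}
    (h : IsSetPartition π H) (hc : π.card = 1) : π = {H} := by
  obtain ⟨h1, h2, h3, h4⟩ := h
  obtain ⟨B, rfl⟩ := card_eq_one.1 hc
  congr 1
  refine Subset.antisymm (h1 B (mem_singleton_self B)) fun a ha => ?_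
  obtain ⟨C, hC, haC⟩ := h4 a ha
  rwa [mem_singleton.1 hC] at haC

theorem isSetPartition_singleton {α : Type*} {H : Finset α} (hH : H.Nonempty) :
    IsSetPartition {H} H := by
  refine ⟨?_, ?_, ?_, ?_⟩ <;> simp_all

theorem sum_proper_cumulants {A : Type*} [CommRing A] {ι : Type*} [DecidableEq ι] (u : Finset ι → A)
    {H : Finset ι} {v : ι} (hv : v ∈ H) :
    ∑ C ∈ (H.powerset.filter (v ∈ ·)).erase H, jointCumulant u C * u (H \ C) =
      ∑ ρ ∈ setPartitions H, ((ρ.card - 1 : ℕ) : A) *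
        ((-1 : A) ^ (ρ.card - 1 - 1) * ((ρ.card - 1 - 1).factorial : A)) * ∏ B ∈ ρ, u B := by
  have h1 : ∀ ρ ∈ setPartitions H, ((ρ.card - 1 : ℕ) : A) *
        ((-1 : A) ^ (ρ.card - 1 - 1) * ((ρ.card - 1 - 1).factorial : A)) * ∏ B ∈ ρ, u B =
      ∑ C ∈ ρ.filter (fun C => v ∉ C),
        ((-1 : A) ^ (ρ.card - 1 - 1) * ((ρ.card - 1 - 1).factorial : A)) * ∏ B ∈ ρ, u B := by
    intro ρ hρ
    rw [sum_const, (mem_setPartitions.1 hρ).card_blocks_notMem hv, nsmul_eq_mul, mul_assoc]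
  rw [sum_congr rfl h1]
  simp only [jointCumulant, sum_mul]
  rw [sum_sigma', sum_sigma']
  refine sum_nbij' (fun x => ⟨insert (H \ x.1) x.2, H \ x.1⟩)
    (fun y => ⟨H \ y.2, y.1.erase y.2⟩) ?_ ?_ ?_ ?_ ?_
  · rintro ⟨C, π⟩ h
    simp only [mem_sigma, mem_erase, mem_filter, mem_powerset, mem_setPartitions, mem_insert,
      mem_sdiff] at h ⊢
    refine ⟨h.2.insert_sdiff (h.1.2.1.ssubset_of_ne h.1.1), Or.inl trivial, ?_⟩
    tauto
  · rintro ⟨ρ, C⟩ h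
    simp only [mem_sigma, mem_erase, mem_filter, mem_powerset, mem_setPartitions,
      mem_sdiff] at h ⊢
    refine ⟨⟨?_, sdiff_subset, hv, h.2.2⟩, h.1.erase_block h.2.1⟩
    intro h'
    obtain ⟨a, ha⟩ := h.1.2.1 C h.2.1
    have := h.1.1 C h.2.1 ha
    rw [← h'] at this
    exact (mem_sdiff.1 this).2 ha
  · rintro ⟨C, π⟩ h
    simp only [mem_sigma, mem_erase, mem_filter, mem_powerset, mem_setPartitions] at h
    have hn : H \ C ∉ π := by
      intro h'
      obtain ⟨a, ha⟩ := h.2.2.1 _ h'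
      exact (mem_sdiff.1 ha).2 (h.2.1 _ h' ha)
    rw [Sigma.mk.injEq, erase_insert hn]
    exact ⟨Finset.sdiff_sdiff_eq_self h.1.2.1, HEq.rfl⟩
  · rintro ⟨ρ, C⟩ h
    simp only [mem_sigma, mem_filter, mem_setPartitions] at h
    rw [Sigma.mk.injEq]
    simp only [Finset.sdiff_sdiff_eq_self (h.1.1 C h.2.1), insert_erase h.2.1]
    exact ⟨trivial, HEq.rfl⟩
  · rintro ⟨C, π⟩ h
    simp only [mem_sigma, mem_erase, mem_filter, mem_powerset, mem_setPartitions] at h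
    have hn : H \ C ∉ π := by
      intro h'
      obtain ⟨a, ha⟩ := h.2.2.1 _ h'
      exact (mem_sdiff.1 ha).2 (h.2.1 _ h' ha)
    simp only [card_insert_of_notMem hn, prod_insert hn, Nat.add_sub_cancel]
    ring

/-- The moment-cumulant relation, organised by the block containing a fixed element `v`. -/
theorem sum_jointCumulant_mul {A : Type*} [CommRing A] {ι : Type*} [DecidableEq ι]
    (u : Finset ι → A)
    (hu : u ∅ = 1) {H : Finset ι} {v : ι} (hv : v ∈ H) :
    ∑ C ∈ H.powerset.filter (v ∈ ·), jointCumulant u C * u (H \ C) = u H := by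
  have hH : H ∈ H.powerset.filter (v ∈ ·) := by simp [hv]
  rw [← add_sum_erase _ _ hH, sum_proper_cumulants u hv, sdiff_self, bot_eq_empty, hu, mul_one,
    jointCumulant, ← sum_add_distrib]
  have hmem : ({H} : Finset (Finset ι)) ∈ setPartitions H :=
    mem_setPartitions.2 (isSetPartition_singleton ⟨v, hv⟩)
  rw [sum_eq_single_of_mem _ hmem]
  · simp
  · intro ρ hρ hne
    rw [mem_setPartitions] at hρ
    obtain ⟨B, hB, -⟩ := hρ.2.2.2 v hv
    obtain ⟨k, hk⟩ : ∃ k, ρ.card = k + 2 := by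
      have h0 : 0 < ρ.card := card_pos.2 ⟨B, hB⟩
      have h1 : ρ.card ≠ 1 := fun h => hne (hρ.eq_singleton h)
      exact ⟨ρ.card - 2, by omega⟩
    rw [hk]
    simp only [Nat.add_succ_sub_one, Nat.add_sub_cancel, Nat.factorial_succ]
    push_cast
    ring

/-! ### Cumulants of the edge-weight function of a multigraph -/

/-- The subsets of `H` containing `v`. -/
def subsetsThrough {V : Type*} [DecidableEq V] (H : Finset V) (v : V) : Finset (Finset V) :=
  H.powerset.filter (v ∈ ·)

theorem mem_subsetsThrough {V : Type*} [DecidableEq V] {H B : Finset V} {v : V} :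
    B ∈ subsetsThrough H v ↔ B ⊆ H ∧ v ∈ B := by
  simp [subsetsThrough]

/-- `E B` is the number of edges of the multigraph with edge multiplicities `e` inside `B`. -/
def IsEdgeCount {V : Type*} [DecidableEq V] (e : V → V → ℕ) (E : Finset V → ℕ) : Prop :=
  E ∅ = 0 ∧ ∀ v B, v ∉ B → E (insert v B) = e v v + ∑ w ∈ B, e v w + E B

section Algebra

variable {A : Type*} [CommRing A] {V : Type*} [DecidableEq V]

theorem sum_subsetsThrough_comm_left (f K U : Finset V → A) (H : Finset V) {u v : V} :
    ∑ C ∈ (subsetsThrough H v).filter (u ∈ ·),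
        (∑ B ∈ subsetsThrough (C.erase v) u, f B * K (C \ B)) * U (H \ C) =
      ∑ B ∈ subsetsThrough (H.erase v) u,
        f B * ∑ C ∈ subsetsThrough (H \ B) v, K C * U ((H \ B) \ C) := by
  simp only [sum_mul, mul_sum]
  rw [sum_sigma', sum_sigma']
  refine sum_nbij' (fun x => ⟨x.2, x.1 \ x.2⟩) (fun y => ⟨y.2 ∪ y.1, y.1⟩) ?_ ?_ ?_ ?_ ?_
  · rintro ⟨C, B⟩ h
    simp only [mem_sigma, mem_filter, mem_subsetsThrough, subset_iff, mem_erase, mem_sdiff] at h ⊢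
    grind
  · rintro ⟨B, C⟩ h
    simp only [mem_sigma, mem_filter, mem_subsetsThrough, subset_iff, mem_erase, mem_sdiff,
      mem_union] at h ⊢
    grind
  · rintro ⟨C, B⟩ h
    simp only [mem_sigma, mem_filter, mem_subsetsThrough] at h
    simp only [sdiff_union_of_subset (h.2.1.trans (erase_subset _ _))]
  · rintro ⟨B, C⟩ h
    simp only [mem_sigma, mem_subsetsThrough] at h
    have : (C ∪ B) \ B = C := union_sdiff_cancel_right (subset_sdiff.1 h.2.1).2
    simp only [this]
  · rintro ⟨C, B⟩ h
    simp only [mem_sigma, mem_filter, mem_subsetsThrough] at h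
    have : (H \ B) \ (C \ B) = H \ C := by
      ext x
      have := h.2.1
      simp only [subset_iff, mem_erase] at this
      simp only [mem_sdiff]
      grind
    simp only [this]
    ring

theorem sum_subsetsThrough_comm_right (K K' U : Finset V → A) (H : Finset V) {u v : V} :
    ∑ C ∈ (subsetsThrough H v).filter (u ∉ ·),
        K C * ∑ B ∈ subsetsThrough (H \ C) u, K' B * U ((H \ C) \ B) =
      ∑ B ∈ subsetsThrough (H.erase v) u,
        K' B * ∑ C ∈ subsetsThrough (H \ B) v, K C * U ((H \ B) \ C) := by
  simp only [mul_sum]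
  rw [sum_comm' (t' := subsetsThrough (H.erase v) u) (s' := fun B => subsetsThrough (H \ B) v)]
  · refine sum_congr rfl fun B _ => sum_congr rfl fun C _ => ?_
    rw [sdiff_right_comm]
    ring
  · intro C B
    simp only [mem_filter, mem_subsetsThrough, subset_iff, mem_erase, mem_sdiff]
    grind

theorem IsEdgeCount.shift {e : V → V → ℕ} {E : Finset V → ℕ} (hE : IsEdgeCount e E)
    {H B : Finset V} {v : V} (hv : v ∈ H) (hB : B ⊆ H.erase v) :
    (∑ b ∈ B, e v b) + E (H \ B) = (e v v + ∑ w ∈ H.erase v, e v w) + E (H.erase v \ B) := by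
  have h1 : H \ B = insert v (H.erase v \ B) := by
    ext x
    have := @hB x
    simp only [mem_sdiff, mem_insert, mem_erase] at this ⊢
    have hvB : v ∉ B := fun h => (mem_erase.1 (hB h)).1 rfl
    by_cases hx : x = v
    · subst hx; simp [hv, hvB]
    · simp [hx]
  rw [h1, hE.2 v _ (by simp), ← sum_sdiff hB]
  ring

/-- Removing the root `v`: recursion for the cumulants of `B ↦ q ^ E B`, organised by the
component, after removal of `v`, of a chosen vertex `u`. -/
theorem jointCumulant_edge_rec {e : V → V → ℕ} {E : Finset V → ℕ} (hE : IsEdgeCount e E)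
    (q : A) {u v : V} (huv : u ≠ v) (H : Finset V) (hv : v ∈ H) (hu : u ∈ H) :
    jointCumulant (fun B => q ^ E B) H =
      ∑ B ∈ subsetsThrough (H.erase v) u, (q ^ (∑ b ∈ B, e v b) - 1) *
        jointCumulant (fun B => q ^ E B) B * jointCumulant (fun B => q ^ E B) (H \ B) := by
  induction H using Finset.strongInduction with
  | H H ih =>
  set U : Finset V → A := fun B => q ^ E B with hU
  set K := jointCumulant U with hK
  have hM : ∀ {X : Finset V} {w : V}, w ∈ X →
      ∑ C ∈ subsetsThrough X w, K C * U (X \ C) = U X :=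
    fun hw => sum_jointCumulant_mul U (by simp [hU, hE.1]) hw
  set f : Finset V → A := fun B => (q ^ (∑ b ∈ B, e v b) - 1) * K B with hf
  have hvB : ∀ B ∈ subsetsThrough (H.erase v) u, v ∈ H \ B := by
    intro B hB
    rw [mem_subsetsThrough] at hB
    exact mem_sdiff.2 ⟨hv, fun h => (mem_erase.1 (hB.1 h)).1 rfl⟩
  have hL := sum_subsetsThrough_comm_left f K U H (u := u) (v := v)
  rw [sum_congr (s₁ := subsetsThrough (H.erase v) u) rfl
    fun B hB => by rw [hM (hvB B hB)]] at hL
  have hR := sum_subsetsThrough_comm_right K K U H (u := u) (v := v)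
  rw [sum_congr (s₁ := subsetsThrough (H.erase v) u) rfl
    fun B hB => by rw [hM (hvB B hB)]] at hR
  rw [sum_congr rfl fun C hC => by
    rw [hM (show u ∈ H \ C from mem_sdiff.2 ⟨hu, (mem_filter.1 hC).2⟩)]] at hR
  have hT : ∑ B ∈ subsetsThrough (H.erase v) u, q ^ (∑ b ∈ B, e v b) * K B * U (H \ B) = U H := by
    have h0 := hE.shift hv (empty_subset (H.erase v))
    simp only [sum_empty, zero_add, sdiff_empty] at h0
    have : U H = q ^ (e v v + ∑ w ∈ H.erase v, e v w) * U (H.erase v) := by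
      simp only [hU, h0, pow_add]
    rw [this, ← hM (mem_erase.2 ⟨huv, hu⟩), mul_sum]
    refine sum_congr rfl fun B hB => ?_
    have := hE.shift hv (mem_subsetsThrough.1 hB).1
    have h2 : q ^ (∑ b ∈ B, e v b) * U (H \ B) =
        q ^ (e v v + ∑ w ∈ H.erase v, e v w) * U (H.erase v \ B) := by
      simp only [hU, ← pow_add, this]
    linear_combination K B * h2
  have hsplit := sum_filter_add_sum_filter_not (subsetsThrough H v) (u ∈ ·)
    (fun C => K C * U (H \ C))
  rw [hM hv] at hsplit
  have hkey : ∑ C ∈ (subsetsThrough H v).filter (u ∈ ·), K C * U (H \ C) =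
      ∑ C ∈ (subsetsThrough H v).filter (u ∈ ·),
        (∑ B ∈ subsetsThrough (C.erase v) u, f B * K (C \ B)) * U (H \ C) := by
    rw [hL]
    have : ∑ B ∈ subsetsThrough (H.erase v) u, f B * U (H \ B) =
        U H - ∑ B ∈ subsetsThrough (H.erase v) u, K B * U (H \ B) := by
      rw [← hT, ← sum_sub_distrib]
      exact sum_congr rfl fun B _ => by simp only [hf]; ring
    rw [this, ← hR]
    linear_combination hsplit
  have hH : H ∈ (subsetsThrough H v).filter (u ∈ ·) := by
    simp [mem_subsetsThrough, hv, hu]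
  rw [← add_sum_erase _ _ hH, ← add_sum_erase _ _ hH, sdiff_self] at hkey
  have hrest : ∑ C ∈ ((subsetsThrough H v).filter (u ∈ ·)).erase H, K C * U (H \ C) =
      ∑ C ∈ ((subsetsThrough H v).filter (u ∈ ·)).erase H,
        (∑ B ∈ subsetsThrough (C.erase v) u, f B * K (C \ B)) * U (H \ C) := by
    refine sum_congr rfl fun C hC => ?_
    simp only [mem_erase, mem_filter, mem_subsetsThrough] at hC
    rw [ih C (hC.2.1.1.ssubset_of_ne hC.1) hC.2.1.2 hC.2.2]
  rw [hrest] at hkey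
  have := add_right_cancel hkey
  simpa [hU, hE.1, hf] using this

end Algebra

/-! ### Rooted trees encoded by parent maps -/

section Trees

variable {V : Type*}

/-- `j` is a descendant of `i` (or `i` itself) for the parent map `p`. -/
def IsDesc (p : V → V) (j i : V) : Prop := ∃ k, p^[k] j = i

theorem IsDesc.refl (p : V → V) (i : V) : IsDesc p i i := ⟨0, rfl⟩

theorem IsDesc.of_apply {p : V → V} {j i : V} (h : IsDesc p (p j) i) : IsDesc p j i := by
  obtain ⟨k, hk⟩ := h
  exact ⟨k + 1, hk⟩

theorem IsDesc.apply_of_ne {p : V → V} {j i : V} (h : IsDesc p j i) (hne : j ≠ i) :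
    IsDesc p (p j) i := by
  obtain ⟨k, hk⟩ := h
  cases k with
  | zero => exact absurd hk hne
  | succ k => exact ⟨k, hk⟩

theorem IsDesc.trans {p : V → V} {i j k : V} (h : IsDesc p i j) (h' : IsDesc p j k) :
    IsDesc p i k := by
  obtain ⟨a, rfl⟩ := h
  obtain ⟨b, rfl⟩ := h'
  exact ⟨b + a, Function.iterate_add_apply p b a i⟩

theorem IsDesc.eq_of_fixed {p : V → V} {i j : V} (h : IsDesc p i j) (hi : p i = i) : j = i := by
  obtain ⟨k, rfl⟩ := h
  exact Function.iterate_fixed hi k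

theorem IsDesc.induction {p : V → V} {i : V} {P : V → Prop} (h0 : P i)
    (h1 : ∀ j, j ≠ i → IsDesc p (p j) i → P (p j) → P j) {j : V} (h : IsDesc p j i) : P j := by
  obtain ⟨k, hk⟩ := h
  induction k generalizing j with
  | zero =>
    obtain rfl : j = i := hk
    exact h0
  | succ k ih =>
    by_cases hj : j = i
    · subst hj
      exact h0
    · exact h1 j hj ⟨k, hk⟩ (ih hk)

/-- If `S` is closed under `p`, descendants of elements outside `S` are outside `S`. -/
theorem IsDesc.mem_of_closed {p : V → V} {S : Set V} (hS : ∀ x ∈ S, p x ∈ S) {i j : V}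
    (h : IsDesc p i j) (hi : i ∈ S) : j ∈ S := by
  obtain ⟨k, rfl⟩ := h
  induction k generalizing i with
  | zero => exact hi
  | succ k ih => exact ih (hS i hi)

theorem exists_branch_root {p : V → V} {u v : V} (huv : u ≠ v) (h : IsDesc p u v) :
    ∃ w, p w = v ∧ w ≠ v ∧ IsDesc p u w := by
  revert huv
  refine h.induction (P := fun y => y ≠ v → ∃ w, p w = v ∧ w ≠ v ∧ IsDesc p y w)
    (fun h => absurd rfl h) ?_
  intro j hj _ ih _
  by_cases hpj : p j = v
  · exact ⟨j, hpj, hj, IsDesc.refl _ _⟩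
  · obtain ⟨w, h1, h2, h3⟩ := ih hpj
    exact ⟨w, h1, h2, h3.of_apply⟩

variable [LinearOrder V]

/-- Attach the tree `p` on `B` with root `w` as a branch to the vertex `v` of the tree `p'`. -/
def graft (B : Finset V) (v w : V) (p p' : V → V) (x : V) : V :=
  if x = w then v else if x ∈ B then p x else p' x

theorem graft_root {B : Finset V} {v w : V} {p p' : V → V} : graft B v w p p' w = v := by
  simp [graft]

theorem graft_of_mem {B : Finset V} {v w : V} {p p' : V → V} {x : V} (hx : x ∈ B) (hne : x ≠ w) :
    graft B v w p p' x = p x := by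
  simp [graft, hx, hne]

theorem graft_of_notMem {B : Finset V} {v w : V} {p p' : V → V} (hw : w ∈ B) {x : V} (hx : x ∉ B) :
    graft B v w p p' x = p' x := by
  have : x ≠ w := fun h => hx (h ▸ hw)
  simp [graft, hx, this]

theorem root_notMem {H B : Finset V} {v : V} (hB : B ⊆ H.erase v) : v ∉ B := fun h =>
  (mem_erase.1 (hB h)).1 rfl

variable [Fintype V]

/-- Spanning trees of the complete graph on `H` rooted at `v`, encoded by parent maps which are
the identity on the root and outside `H`. -/
def rootedTrees (H : Finset V) (v : V) : Finset (V → V) :=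
  univ.filter fun p => p v = v ∧ (∀ w, w ∉ H → p w = w) ∧ ∀ w ∈ H, p w ∈ H ∧ IsDesc p w v

theorem mem_rootedTrees {H : Finset V} {v : V} {p : V → V} :
    p ∈ rootedTrees H v ↔
      p v = v ∧ (∀ w, w ∉ H → p w = w) ∧ ∀ w ∈ H, p w ∈ H ∧ IsDesc p w v := by
  simp [rootedTrees]

section Graft

variable {H B : Finset V} {v w : V} {p p' : V → V}

theorem rootedTrees.apply_notMem (hp' : p' ∈ rootedTrees (H \ B) v) {x : V}
    (hx : x ∉ B) : p' x ∉ B := by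
  obtain ⟨-, h2, h3⟩ := mem_rootedTrees.1 hp'
  by_cases hxH : x ∈ H
  · exact (mem_sdiff.1 (h3 x (mem_sdiff.2 ⟨hxH, hx⟩)).1).2
  · rw [h2 x fun h => hxH (mem_sdiff.1 h).1]
    exact hx

theorem isDesc_graft_of_notMem (hw : w ∈ B)
    (hp' : p' ∈ rootedTrees (H \ B) v) {x i : V} (hx : x ∉ B) :
    IsDesc (graft B v w p p') x i ↔ IsDesc p' x i := by
  have key : ∀ k, (graft B v w p p')^[k] x = p'^[k] x ∧ p'^[k] x ∉ B := by
    intro k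
    induction k with
    | zero => exact ⟨rfl, hx⟩
    | succ k ih =>
      rw [Function.iterate_succ_apply', Function.iterate_succ_apply', ih.1]
      exact ⟨graft_of_notMem hw ih.2, rootedTrees.apply_notMem hp' ih.2⟩
  exact exists_congr fun k => by rw [(key k).1]

theorem graft_notMem (hw : w ∈ B) (hp' : p' ∈ rootedTrees (H \ B) v)
    {x : V} (hx : x ∉ B) : graft B v w p p' x ∉ B := by
  rw [graft_of_notMem hw hx]
  exact rootedTrees.apply_notMem hp' hx

theorem not_isDesc_graft (hw : w ∈ B) (hp' : p' ∈ rootedTrees (H \ B) v)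
    {x i : V} (hx : x ∉ B) (hi : i ∈ B) : ¬ IsDesc (graft B v w p p') x i := fun h =>
  h.mem_of_closed (S := {y | y ∉ B}) (fun _ hy => graft_notMem hw hp' hy) hx hi

theorem graft_fixed_root (hB : B ⊆ H.erase v) (hw : w ∈ B) (hp' : p' ∈ rootedTrees (H \ B) v) :
    graft B v w p p' v = v := by
  rw [graft_of_notMem hw (root_notMem hB), (mem_rootedTrees.1 hp').1]

theorem isDesc_graft_mem_or (hB : B ⊆ H.erase v) (hw : w ∈ B) (hp : p ∈ rootedTrees B w)
    (hp' : p' ∈ rootedTrees (H \ B) v) {x i : V} (hx : x ∈ B)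
    (h : IsDesc (graft B v w p p') x i) : i ∈ B ∨ i = v := by
  refine h.mem_of_closed (S := {y | y ∈ B ∨ y = v}) ?_ (Or.inl hx)
  rintro y (hy | rfl)
  · by_cases hyw : y = w
    · subst hyw
      exact Or.inr graft_root
    · rw [graft_of_mem hy hyw]
      exact Or.inl ((mem_rootedTrees.1 hp).2.2 y hy).1
  · exact Or.inr (graft_fixed_root hB hw hp')

theorem isDesc_graft_of_mem (hB : B ⊆ H.erase v) (hw : w ∈ B) (hp : p ∈ rootedTrees B w)
    (hp' : p' ∈ rootedTrees (H \ B) v) {x i : V} (hx : x ∈ B) (hi : i ∈ B) :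
    IsDesc (graft B v w p p') x i ↔ IsDesc p x i := by
  obtain ⟨h1, -, h3⟩ := mem_rootedTrees.1 hp
  constructor
  · intro h
    revert hx
    refine h.induction (P := fun y => y ∈ B → IsDesc p y i) (fun _ => IsDesc.refl _ _) ?_
    intro j _ hd ih hj
    by_cases hjw : j = w
    · subst hjw
      rw [graft_root] at hd
      exact absurd (hd.eq_of_fixed (graft_fixed_root hB hw hp'))
        fun h => root_notMem hB (h ▸ hi)
    · rw [graft_of_mem hj hjw] at ih
      exact (ih (h3 j hj).1).of_apply
  · intro h
    revert hx
    refine h.induction (P := fun y => y ∈ B → IsDesc (graft B v w p p') y i)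
      (fun _ => IsDesc.refl _ _) ?_
    intro j hji hd ih hj
    by_cases hjw : j = w
    · subst hjw
      rw [h1] at hd ih
      exact ih hj
    · refine IsDesc.of_apply ?_
      rw [graft_of_mem hj hjw]
      exact ih (h3 j hj).1

theorem isDesc_graft_branch_root (hB : B ⊆ H.erase v) (hw : w ∈ B) (hp : p ∈ rootedTrees B w)
    (hp' : p' ∈ rootedTrees (H \ B) v) {x : V} : IsDesc (graft B v w p p') x w ↔ x ∈ B := by
  constructor
  · intro h
    by_contra hx
    exact not_isDesc_graft hw hp' hx hw h
  · intro hx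
    exact (isDesc_graft_of_mem hB hw hp hp' hx hw).2 ((mem_rootedTrees.1 hp).2.2 x hx).2

theorem graft_mem (hv : v ∈ H) (hB : B ⊆ H.erase v) (hw : w ∈ B) (hp : p ∈ rootedTrees B w)
    (hp' : p' ∈ rootedTrees (H \ B) v) : graft B v w p p' ∈ rootedTrees H v := by
  have hBH : ∀ x ∈ B, x ∈ H := fun x hx => mem_of_mem_erase (hB hx)
  refine mem_rootedTrees.2 ⟨graft_fixed_root hB hw hp', ?_, ?_⟩
  · intro x hx
    rw [graft_of_notMem hw fun h => hx (hBH x h)]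
    exact (mem_rootedTrees.1 hp').2.1 x fun h => hx (mem_sdiff.1 h).1
  · intro x hx
    by_cases hxB : x ∈ B
    · constructor
      · by_cases hxw : x = w
        · subst hxw
          rwa [graft_root]
        · rw [graft_of_mem hxB hxw]
          exact hBH _ ((mem_rootedTrees.1 hp).2.2 x hxB).1
      · refine ((isDesc_graft_branch_root hB hw hp hp').2 hxB).trans (IsDesc.of_apply ?_)
        rw [graft_root]
        exact IsDesc.refl _ _
    · obtain ⟨h1, h2⟩ := (mem_rootedTrees.1 hp').2.2 x (mem_sdiff.2 ⟨hx, hxB⟩)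
      exact ⟨by rw [graft_of_notMem hw hxB]; exact (mem_sdiff.1 h1).1,
        (isDesc_graft_of_notMem hw hp' hxB).2 h2⟩

theorem branch_root_unique (hB : B ⊆ H.erase v) (hw : w ∈ B) (hp : p ∈ rootedTrees B w)
    (hp' : p' ∈ rootedTrees (H \ B) v) {u y : V} (hu : u ∈ B)
    (hy : graft B v w p p' y = v) (hyv : y ≠ v) (huy : IsDesc (graft B v w p p') u y) :
    y = w := by
  by_contra hyw
  have hyB : y ∈ B := (isDesc_graft_mem_or hB hw hp hp' hu huy).resolve_right hyv
  rw [graft_of_mem hyB hyw] at hy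
  exact root_notMem hB (hy ▸ ((mem_rootedTrees.1 hp).2.2 y hyB).1)

end Graft

theorem graft_injective {H : Finset V} {u v : V} {B C : Finset V} {w y : V} {p p' s s' : V → V}
    (hB : B ⊆ H.erase v) (huB : u ∈ B) (hw : w ∈ B)
    (hp : p ∈ rootedTrees B w) (hp' : p' ∈ rootedTrees (H \ B) v)
    (hC : C ⊆ H.erase v) (huC : u ∈ C) (hy : y ∈ C)
    (hs : s ∈ rootedTrees C y) (hs' : s' ∈ rootedTrees (H \ C) v)
    (h : graft B v w p p' = graft C v y s s') : B = C ∧ w = y ∧ p = s ∧ p' = s' := by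
  have hyw : y = w := by
    refine branch_root_unique hB hw hp hp' huB ?_ ?_ ?_
    · rw [h, graft_root]
    · exact fun h => root_notMem hC (h ▸ hy)
    · rw [h]
      exact (isDesc_graft_branch_root hC hy hs hs').2 huC
  subst hyw
  have hBC : B = C := by
    ext x
    rw [← isDesc_graft_branch_root hB hw hp hp', h, isDesc_graft_branch_root hC hy hs hs']
  subst hBC
  refine ⟨rfl, rfl, ?_, ?_⟩
  · ext x
    by_cases hx : x ∈ B
    · by_cases hxy : x = y
      · subst hxy
        rw [(mem_rootedTrees.1 hp).1, (mem_rootedTrees.1 hs).1]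
      · have := congrFun h x
        rwa [graft_of_mem hx hxy, graft_of_mem hx hxy] at this
    · rw [(mem_rootedTrees.1 hp).2.1 x hx, (mem_rootedTrees.1 hs).2.1 x hx]
  · ext x
    by_cases hx : x ∈ B
    · have hx' : x ∉ H \ B := fun h => (mem_sdiff.1 h).2 hx
      rw [(mem_rootedTrees.1 hp').2.1 x hx', (mem_rootedTrees.1 hs').2.1 x hx']
    · have := congrFun h x
      rwa [graft_of_notMem hw hx, graft_of_notMem hw hx] at this

theorem graft_surjective {H : Finset V} {u v : V} (hu : u ∈ H) (huv : u ≠ v)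
    {p : V → V} (hp : p ∈ rootedTrees H v) :
    ∃ B, B ⊆ H.erase v ∧ u ∈ B ∧ ∃ w ∈ B, ∃ s ∈ rootedTrees B w, ∃ s' ∈ rootedTrees (H \ B) v,
      graft B v w s s' = p := by
  obtain ⟨h1, h2, h3⟩ := mem_rootedTrees.1 hp
  obtain ⟨w, hwv, hne, huw⟩ := exists_branch_root huv (h3 u hu).2
  have hwH : w ∈ H := by
    by_contra hw
    exact hne ((h2 w hw).symm.trans hwv)
  have hvw : ¬ IsDesc p v w := fun h => hne (h.eq_of_fixed h1)
  set B := H.filter (fun x => IsDesc p x w) with hBdef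
  have hwB : w ∈ B := mem_filter.2 ⟨hwH, IsDesc.refl _ _⟩
  have hBH : ∀ x ∈ B, x ∈ H := fun x hx => (mem_filter.1 hx).1
  have hpB : ∀ x ∈ B, x ≠ w → p x ∈ B := fun x hx hxw =>
    mem_filter.2 ⟨(h3 x (hBH x hx)).1, (mem_filter.1 hx).2.apply_of_ne hxw⟩
  have hpC : ∀ x ∈ H, x ∉ B → p x ∉ B := fun x hx hxB h =>
    hxB (mem_filter.2 ⟨hx, (mem_filter.1 h).2.of_apply⟩)
  have hvB : v ∉ B := fun h => hvw (mem_filter.1 h).2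
  refine ⟨B, ?_, mem_filter.2 ⟨hu, huw⟩, w, hwB, fun x => if x ∈ B ∧ x ≠ w then p x else x, ?_,
    fun x => if x ∈ B then x else p x, ?_, ?_⟩
  · intro x hx
    exact mem_erase.2 ⟨fun h => hvB (h ▸ hx), hBH x hx⟩
  · refine mem_rootedTrees.2 ⟨by simp, fun x hx => by simp [hx], fun x hx => ⟨?_, ?_⟩⟩
    · by_cases hxw : x = w
      · simp [hxw, hwB]
      · simpa [hx, hxw] using hpB x hx hxw
    · revert hx
      have hd : x ∈ B → IsDesc p x w := fun hx => (mem_filter.1 hx).2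
      intro hx
      have hd := hd hx
      revert hx
      refine hd.induction (P := fun y => y ∈ B →
        IsDesc (fun x => if x ∈ B ∧ x ≠ w then p x else x) y w) (fun _ => IsDesc.refl _ _) ?_
      intro j hj _ ih hjB
      refine IsDesc.of_apply ?_
      simpa [hjB, hj] using ih (hpB j hjB hj)
  · refine mem_rootedTrees.2 ⟨by simp [hvB, h1], fun x hx => ?_, fun x hx => ?_⟩
    · by_cases hxB : x ∈ B
      · simp [hxB]
      · have : x ∉ H := fun h => hx (mem_sdiff.2 ⟨h, hxB⟩)
        simp [h2 x this]
    · obtain ⟨hxH, hxB⟩ := mem_sdiff.1 hx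
      refine ⟨?_, ?_⟩
      · simpa [hxB] using ⟨(h3 x hxH).1, hpC x hxH hxB⟩
      · have hd := (h3 x hxH).2
        revert hx
        refine hd.induction (P := fun y => y ∈ H \ B →
          IsDesc (fun x => if x ∈ B then x else p x) y v) (fun _ => IsDesc.refl _ _) ?_
        intro j hj _ ih hjB
        obtain ⟨hjH, hjB⟩ := mem_sdiff.1 hjB
        refine IsDesc.of_apply ?_
        simpa [hjB] using ih (mem_sdiff.2 ⟨(h3 j hjH).1, hpC j hjH hjB⟩)
  · ext x
    by_cases hxw : x = w
    · rw [hxw, graft_root, hwv]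
    · by_cases hxB : x ∈ B
      · rw [graft_of_mem hxB hxw]
        simp [hxB, hxw]
      · rw [graft_of_notMem hwB hxB]
        simp [hxB]

end Trees

/-! ### The tree sum and the `G`-inversion polynomial -/

section TreeSum

variable {A : Type*} [CommRing A] {V : Type*} [Fintype V] [LinearOrder V]

/-- The weight `(q ^ e_{i, p(i)} - 1) q ^ (Σ_j e_{p(i), j})` of the edge joining `i` to its parent,
`j` ranging over the descendants of `i` smaller than `i`. -/
def edgeWeight (e : V → V → ℕ) (q : A) (p : V → V) (i : V) : A :=
  (q ^ e i (p i) - 1) * q ^ ∑ j ∈ univ.filter (fun j => j < i ∧ IsDesc p j i), e (p i) j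

/-- The weighted sum over spanning trees of `H` rooted at `v`. -/
def treeSum (e : V → V → ℕ) (q : A) (H : Finset V) (v : V) : A :=
  ∑ p ∈ rootedTrees H v, ∏ i ∈ H.erase v, edgeWeight e q p i

theorem edgeWeight_congr (e : V → V → ℕ) (q : A) {p s : V → V} {i : V} (h : p i = s i)
    (hd : ∀ j, IsDesc p j i ↔ IsDesc s j i) : edgeWeight e q p i = edgeWeight e q s i := by
  simp only [edgeWeight, h, hd]

theorem prod_edgeWeight_graft (e : V → V → ℕ) (q : A) {H B : Finset V} {v w : V} {p p' : V → V}
    (hB : B ⊆ H.erase v) (hw : w ∈ B) (hp : p ∈ rootedTrees B w)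
    (hp' : p' ∈ rootedTrees (H \ B) v) :
    ∏ i ∈ H.erase v, edgeWeight e q (graft B v w p p') i =
      (q ^ e w v - 1) * q ^ (∑ j ∈ B.filter (· < w), e v j) *
        (∏ i ∈ B.erase w, edgeWeight e q p i) * ∏ i ∈ (H \ B).erase v, edgeWeight e q p' i := by
  have hsplit : H.erase v \ B = (H \ B).erase v := by
    ext x
    simp only [mem_sdiff, mem_erase]
    tauto
  rw [← prod_sdiff hB, hsplit, ← mul_prod_erase B _ hw, mul_comm]
  have h1 : ∏ i ∈ (H \ B).erase v, edgeWeight e q (graft B v w p p') i =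
      ∏ i ∈ (H \ B).erase v, edgeWeight e q p' i := by
    refine prod_congr rfl fun i hi => ?_
    obtain ⟨hiv, hi⟩ := mem_erase.1 hi
    have hiB := (mem_sdiff.1 hi).2
    refine edgeWeight_congr e q (graft_of_notMem hw hiB) fun j => ?_
    by_cases hj : j ∈ B
    · refine iff_of_false (fun h => ?_) (fun h => ?_)
      · rcases isDesc_graft_mem_or hB hw hp hp' hj h with h | h
        · exact hiB h
        · exact hiv h
      · have := h.eq_of_fixed ((mem_rootedTrees.1 hp').2.1 j fun h => (mem_sdiff.1 h).2 hj)
        exact hiB (this ▸ hj)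
    · exact isDesc_graft_of_notMem hw hp' hj
  have h2 : ∏ i ∈ B.erase w, edgeWeight e q (graft B v w p p') i =
      ∏ i ∈ B.erase w, edgeWeight e q p i := by
    refine prod_congr rfl fun i hi => ?_
    obtain ⟨hiw, hi⟩ := mem_erase.1 hi
    refine edgeWeight_congr e q (graft_of_mem hi hiw) fun j => ?_
    by_cases hj : j ∈ B
    · exact isDesc_graft_of_mem hB hw hp hp' hj hi
    · refine iff_of_false (fun h => not_isDesc_graft hw hp' hj hi h) (fun h => ?_)
      have := h.eq_of_fixed ((mem_rootedTrees.1 hp).2.1 j hj)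
      exact hj (this ▸ hi)
  have h3 : edgeWeight e q (graft B v w p p') w =
      (q ^ e w v - 1) * q ^ (∑ j ∈ B.filter (· < w), e v j) := by
    simp only [edgeWeight, graft_root, isDesc_graft_branch_root hB hw hp hp']
    congr 3
    ext j
    simp [and_comm]
  rw [h1, h2, h3]

theorem treeSum_rec (e : V → V → ℕ) (q : A) {H : Finset V} {u v : V} (hv : v ∈ H) (hu : u ∈ H)
    (huv : u ≠ v) :
    treeSum e q H v = ∑ B ∈ subsetsThrough (H.erase v) u,
      (∑ w ∈ B, (q ^ e w v - 1) * q ^ (∑ j ∈ B.filter (· < w), e v j) * treeSum e q B w) *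
        treeSum e q (H \ B) v := by
  simp only [treeSum, mul_sum, sum_mul]
  simp only [sum_sigma']
  symm
  refine sum_bij (fun x _ => graft x.1 v x.2.2.1 x.2.2.2 x.2.1) ?_ ?_ ?_ ?_
  · rintro ⟨B, p', w, p⟩ h
    simp only [mem_sigma, mem_subsetsThrough] at h
    exact graft_mem hv h.1.1 h.2.2.1 h.2.2.2 h.2.1
  · rintro ⟨B, p', w, p⟩ h ⟨C, s', y, s⟩ h' heq
    simp only [mem_sigma, mem_subsetsThrough] at h h'
    obtain ⟨rfl, rfl, rfl, rfl⟩ := graft_injective h.1.1 h.1.2 h.2.2.1 h.2.2.2 h.2.1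
      h'.1.1 h'.1.2 h'.2.2.1 h'.2.2.2 h'.2.1 heq
    rfl
  · intro p hp
    obtain ⟨B, hB, huB, w, hw, s, hs, s', hs', rfl⟩ := graft_surjective hu huv hp
    refine ⟨⟨B, s', w, s⟩, ?_, rfl⟩
    simp only [mem_sigma, mem_subsetsThrough]
    exact ⟨⟨hB, huB⟩, hs', hw, hs⟩
  · rintro ⟨B, p', w, p⟩ h
    simp only [mem_sigma, mem_subsetsThrough] at h
    exact (prod_edgeWeight_graft e q h.1.1 h.2.2.1 h.2.2.2 h.2.1).symm

theorem treeSum_singleton (e : V → V → ℕ) (q : A) (v : V) : treeSum e q {v} v = 1 := by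
  have : rootedTrees {v} v = {id} := by
    ext p
    rw [mem_rootedTrees, mem_singleton]
    constructor
    · rintro ⟨h1, h2, -⟩
      ext x
      by_cases hx : x = v
      · rw [hx, h1, id]
      · exact h2 x (by simpa using hx)
    · rintro rfl
      refine ⟨rfl, fun _ _ => rfl, fun x hx => ⟨hx, ?_⟩⟩
      rw [mem_singleton.1 hx]
      exact IsDesc.refl _ _
  simp [treeSum, this]

omit [Fintype V] in
theorem sum_ordered_pow_sub_one (a : V → ℕ) (q : A) (B : Finset V) :
    ∑ w ∈ B, (q ^ a w - 1) * q ^ (∑ j ∈ B.filter (· < w), a j) = q ^ (∑ w ∈ B, a w) - 1 := by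
  have := prod_add_ordered B (fun _ => (1 : A)) (fun w => q ^ a w - 1)
  simp only [add_sub_cancel, prod_const_one, mul_one] at this
  rw [← prod_pow_eq_pow_sum, this, add_sub_cancel_left]
  exact sum_congr rfl fun w _ => by rw [prod_pow_eq_pow_sum]

/-- The cumulant of `B ↦ q ^ E B` is a weighted sum over spanning trees, for any choice of root. -/
theorem jointCumulant_eq_treeSum {e : V → V → ℕ} (he : ∀ i j, e i j = e j i) {E : Finset V → ℕ}
    (hE : IsEdgeCount e E) (q : A) (H : Finset V) {v : V} (hv : v ∈ H) :
    jointCumulant (fun B => q ^ E B) H = q ^ (∑ i ∈ H, e i i) * treeSum e q H v := by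
  induction H using Finset.strongInduction generalizing v with
  | H H ih =>
  by_cases hu : ∃ u ∈ H, u ≠ v
  · obtain ⟨u, hu, huv⟩ := hu
    rw [jointCumulant_edge_rec hE q huv H hv hu, treeSum_rec e q hv hu huv, mul_sum]
    refine sum_congr rfl fun B hB => ?_
    obtain ⟨hBH, huB⟩ := mem_subsetsThrough.1 hB
    have hvB := root_notMem hBH
    have hBH' : B ⊆ H := hBH.trans (erase_subset _ _)
    have hvHB : v ∈ H \ B := mem_sdiff.2 ⟨hv, hvB⟩
    rw [← sum_ordered_pow_sub_one, ih (H \ B) (sdiff_ssubset hBH' ⟨u, huB⟩) hvHB, sum_mul,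
      ← sum_sdiff hBH', pow_add]
    have : ∀ w ∈ B, (q ^ e v w - 1) * q ^ (∑ j ∈ B.filter (· < w), e v j) *
        jointCumulant (fun B => q ^ E B) B = q ^ (∑ i ∈ B, e i i) *
        ((q ^ e w v - 1) * q ^ (∑ j ∈ B.filter (· < w), e v j) * treeSum e q B w) := by
      intro w hw
      rw [ih B (ssubset_of_subset_of_ne hBH' fun h => hvB (h ▸ hv)) hw, he v w]
      ring
    rw [sum_congr rfl this, ← mul_sum]
    ring
  · have hH : H = {v} := by
      ext x
      rw [mem_singleton]
      refine ⟨fun hx => ?_, fun h => h ▸ hv⟩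
      by_contra hne
      exact hu ⟨x, hx, hne⟩
    subst hH
    have h1 : E {v} = e v v := by
      have := hE.2 v ∅ (notMem_empty v)
      simpa [hE.1] using this
    have := sum_jointCumulant_mul (fun B => q ^ E B) (by simp [hE.1]) (mem_singleton_self v)
    rw [sum_eq_single_of_mem {v} (by simp)] at this
    · simpa [hE.1, treeSum_singleton, h1] using this
    · intro B hB hne
      simp only [mem_filter, mem_powerset, subset_singleton_iff] at hB
      rcases hB.1 with rfl | rfl
      · exact absurd hB.2 (notMem_empty v)
      · exact absurd rfl hne

end TreeSum

theorem sub_one_mul_nq {A : Type*} [CommRing A] (q : A) (m : ℕ) :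
    (q - 1) * nq q m = q ^ m - 1 := mul_geom_sum q m

theorem kappaStat_eq {r : ℕ} {e : Fin (r+1) → Fin (r+1) → ℕ} (he : ∀ i j, e i j = e j i)
    {p : Fin (r+1) → Fin (r+1)} (hp : p ∈ rootedTrees univ 0) :
    kappaStat e p = ∑ i ∈ univ.erase 0,
      ∑ j ∈ univ.filter (fun j => j < i ∧ IsDesc p j i), e (p i) j := by
  obtain ⟨h1, -, h3⟩ := mem_rootedTrees.1 hp
  have h0 : ∀ i j, i ≠ 0 → IsDesc p j i → j ≠ 0 := by
    rintro i j hi hd rfl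
    exact hi (hd.eq_of_fixed h1)
  have hcyc : ∀ i j, i ≠ 0 → IsDesc p j i → p i ≠ j := by
    intro i j hi hd hij
    have hcl : ∀ x, IsDesc p x i → IsDesc p (p x) i := by
      intro x hx
      by_cases hxi : x = i
      · rw [hxi, hij]
        exact hd
      · exact hx.apply_of_ne hxi
    have := (h3 i (mem_univ i)).2.mem_of_closed (S := {x | IsDesc p x i}) hcl (IsDesc.refl p i)
    exact h0 i 0 hi this rfl
  rw [kappaStat, sum_filter, sum_product, sum_erase univ (by simp)]
  refine sum_congr rfl fun i _ => ?_
  rw [sum_filter]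
  refine sum_congr rfl fun j _ => ?_
  dsimp only
  by_cases hd : j < i ∧ IsDesc p j i
  · have hi : i ≠ 0 := (Fin.zero_le j |>.trans_lt hd.1).ne'
    rw [if_pos hd]
    by_cases hej : 0 < e j (p i)
    · exact if_pos ⟨hi, h0 i j hi hd.2, hd.1.ne', hd.2, hd.1, hcyc i j hi hd.2, hej⟩
    · have : e (p i) j = 0 := by
        rw [he]
        omega
      rw [this, ite_self]
  · rw [if_neg hd, if_neg]
    rintro ⟨-, -, -, h1, h2, -⟩
    exact hd ⟨h2, h1⟩

theorem Iinv_eq_treeSum {A : Type*} [CommRing A] {r : ℕ} {e : Fin (r+1) → Fin (r+1) → ℕ}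
    (he : ∀ i j, e i j = e j i) (q : A) :
    (q - 1) ^ r * Iinv e q = q ^ (∑ i, e i i) * treeSum e q univ 0 := by
  have hprod : ∀ p ∈ rootedTrees univ (0 : Fin (r+1)),
      ∏ i ∈ univ.erase 0, edgeWeight e q p i =
        (q - 1) ^ r * (q ^ kappaStat e p * ∏ w ∈ univ.erase (0 : Fin (r+1)), nq q (e w (p w))) := by
    intro p hp
    simp only [edgeWeight, ← sub_one_mul_nq]
    rw [prod_mul_distrib, prod_mul_distrib, prod_const, prod_pow_eq_pow_sum, ← kappaStat_eq he hp,
      card_erase_of_mem (mem_univ _), card_univ, Fintype.card_fin, Nat.add_sub_cancel]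
    ring
  rw [Iinv, treeSum, sum_congr rfl hprod, ← mul_sum]
  have hsub : parentMaps e ⊆ rootedTrees univ 0 := by
    intro p hp
    simp only [parentMaps, mem_filter, mem_univ, true_and] at hp
    exact mem_rootedTrees.2 ⟨hp.1, by simp, fun w _ => ⟨mem_univ _, hp.2.2 w⟩⟩
  rw [sum_subset hsub]
  · ring
  · intro p hp hn
    obtain ⟨h1, -, h3⟩ := mem_rootedTrees.1 hp
    have : ∃ w, w ≠ 0 ∧ e w (p w) = 0 := by
      by_contra! hcon
      refine hn ?_
      simp only [parentMaps, mem_filter, mem_univ, true_and]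
      refine ⟨h1, fun w hw => ⟨fun hpw => ?_, Nat.pos_of_ne_zero (hcon w hw)⟩,
        fun w => (h3 w (mem_univ w)).2⟩
      exact hw ((h3 w (mem_univ w)).2.eq_of_fixed hpw).symm
    obtain ⟨w, hw, hew⟩ := this
    rw [prod_eq_zero (mem_erase.2 ⟨hw, mem_univ w⟩), mul_zero]
    simp [hew, nq]

/-- The cumulant of the edge weights of a multigraph is its `G`-inversion polynomial. -/
theorem jointCumulant_eq_Iinv {A : Type*} [CommRing A] {r : ℕ} {e : Fin (r+1) → Fin (r+1) → ℕ}
    (he : ∀ i j, e i j = e j i) {E : Finset (Fin (r+1)) → ℕ} (hE : IsEdgeCount e E) (q : A) :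
    jointCumulant (fun B => q ^ E B) univ = (q - 1) ^ r * Iinv e q := by
  rw [Iinv_eq_treeSum he, jointCumulant_eq_treeSum he hE q univ (mem_univ 0)]

/-! ### Diagrams and the coloring of their columns -/

theorem IsPartitionFun.le_nRows {f : ℕ → ℕ} (hf : IsPartitionFun f) {j : ℕ} (hj : f j ≠ 0) :
    j ≤ nRows f := by
  obtain ⟨hanti, N, hN⟩ := hf
  refine le_csSup ⟨N, fun k hk => ?_⟩ hj
  by_contra! h
  exact hk (Nat.eq_zero_of_le_zero (hN ▸ hanti h.le))

theorem IsPartitionFun.mem_cells {f : ℕ → ℕ} (hf : IsPartitionFun f) {c : ℕ × ℕ} :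
    c ∈ cells f ↔ 1 ≤ c.1 ∧ 1 ≤ c.2 ∧ c.1 ≤ f c.2 := by
  simp only [cells, mem_filter, mem_product, mem_Icc]
  constructor
  · tauto
  · rintro ⟨h1, h2, h3⟩
    exact ⟨⟨⟨h1, h3.trans (hf.1 h2)⟩, h2, hf.le_nRows (by omega)⟩, h3⟩

theorem IsPartitionFun.le_colLen {f : ℕ → ℕ} (hf : IsPartitionFun f) {i j : ℕ} (hi : 1 ≤ i)
    (hj : 1 ≤ j) : j ≤ colLen f i ↔ i ≤ f j := by
  constructor
  · intro h
    by_contra! hlt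
    have : (Icc 1 (nRows f)).filter (fun j => i ≤ f j) ⊆ Icc 1 (j - 1) := by
      intro k hk
      simp only [mem_filter, mem_Icc] at hk ⊢
      refine ⟨hk.1.1, ?_⟩
      by_contra! hjk
      have := hf.1 (show j ≤ k by omega)
      omega
    have := card_le_card this
    rw [Nat.card_Icc] at this
    rw [colLen] at h
    omega
  · intro h
    have : Icc 1 j ⊆ (Icc 1 (nRows f)).filter (fun j => i ≤ f j) := by
      intro k hk
      simp only [mem_filter, mem_Icc] at hk ⊢
      have := hf.1 hk.2
      exact ⟨⟨hk.1, hf.le_nRows (by omega)⟩, by omega⟩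
    simpa [colLen] using card_le_card this

theorem isPartitionFun_lamB {r : ℕ} {lam : Fin (r+1) → ℕ → ℕ} (hlam : ∀ b, IsPartitionFun (lam b))
    (B : Finset (Fin (r+1))) : IsPartitionFun (lamB lam B) := by
  refine ⟨fun i j h => sum_le_sum fun b _ => (hlam b).1 h, ?_⟩
  choose N hN using fun b => (hlam b).2
  refine ⟨univ.sup N, sum_eq_zero fun b _ => ?_⟩
  exact Nat.eq_zero_of_le_zero (hN b ▸ (hlam b).1 (le_sup (mem_univ b)))

section Coloring

variable {r : ℕ} {lam : Fin (r+1) → ℕ → ℕ}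

theorem mem_columnPairs_univ {p : Fin (r+1) × ℕ} :
    p ∈ columnPairs lam univ ↔ 1 ≤ p.2 ∧ p.2 ≤ lam p.1 1 := by
  simp only [columnPairs, mem_filter, mem_product, mem_univ, true_and, mem_Icc]
  have : lam p.1 1 ≤ lamB lam univ 1 :=
    single_le_sum (f := fun b => lam b 1) (fun _ _ => Nat.zero_le _) (mem_univ p.1)
  constructor
  · tauto
  · rintro ⟨h1, h2⟩
    exact ⟨⟨h1, h2.trans this⟩, h2⟩

theorem colBefore_refl (p : Fin (r+1) × ℕ) : colBefore lam p p :=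
  Or.inr ⟨rfl, Or.inr ⟨rfl, le_rfl⟩⟩

theorem colBefore_total (p p' : Fin (r+1) × ℕ) : colBefore lam p p' ∨ colBefore lam p' p := by
  unfold colBefore
  rcases lt_trichotomy (colLen (lam p.1) p.2) (colLen (lam p'.1) p'.2) with h | h | h
  · exact Or.inr (Or.inl h)
  · rcases lt_trichotomy p.1 p'.1 with h' | h' | h'
    · exact Or.inl (Or.inr ⟨h, Or.inl h'⟩)
    · rcases le_total p.2 p'.2 with h2 | h2
      · exact Or.inl (Or.inr ⟨h, Or.inr ⟨h', h2⟩⟩)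
      · exact Or.inr (Or.inr ⟨h.symm, Or.inr ⟨h'.symm, h2⟩⟩)
    · exact Or.inr (Or.inr ⟨h.symm, Or.inl h'⟩)
  · exact Or.inl (Or.inl h)

theorem colBefore_trans {p p' p'' : Fin (r+1) × ℕ} (h : colBefore lam p p')
    (h' : colBefore lam p' p'') : colBefore lam p p'' := by
  unfold colBefore at *
  rcases h with h | ⟨h1, h2⟩ <;> rcases h' with h' | ⟨h1', h2'⟩
  · exact Or.inl (h'.trans h)
  · exact Or.inl (h1' ▸ h)
  · exact Or.inl (h1 ▸ h')
  · refine Or.inr ⟨h1.trans h1', ?_⟩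
    rcases h2 with h2 | ⟨h2, h3⟩ <;> rcases h2' with h2' | ⟨h2', h3'⟩
    · exact Or.inl (h2.trans h2')
    · exact Or.inl (h2' ▸ h2)
    · exact Or.inl (h2 ▸ h2')
    · exact Or.inr ⟨h2.trans h2', h3.trans h3'⟩

theorem colBefore_antisymm {p p' : Fin (r+1) × ℕ} (h : colBefore lam p p')
    (h' : colBefore lam p' p) : p = p' := by
  unfold colBefore at *
  rcases h with h | ⟨h1, h2⟩ <;> rcases h' with h' | ⟨h1', h2'⟩
  · omega
  · omega
  · omega
  · rcases h2 with h2 | ⟨h2, h3⟩ <;> rcases h2' with h2' | ⟨h2', h3'⟩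
    · exact absurd h2 h2'.not_gt
    · exact absurd h2'.symm h2.ne
    · exact absurd h2.symm h2'.ne
    · exact Prod.ext h2 (le_antisymm h3 h3')

theorem posIn_injOn : Set.InjOn (fun p : Fin (r+1) × ℕ => posIn lam univ p.1 p.2)
    (columnPairs lam univ) := by
  have key : ∀ p ∈ columnPairs lam univ, ∀ p' ∈ columnPairs lam univ, colBefore lam p p' →
      p ≠ p' → posIn lam univ p.1 p.2 < posIn lam univ p'.1 p'.2 := by
    intro p _ p' hp' hb hne
    refine card_lt_card ⟨?_, fun hsub => ?_⟩
    · intro x hx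
      simp only [mem_filter] at hx ⊢
      exact ⟨hx.1, colBefore_trans hx.2 hb⟩
    · have := hsub (mem_filter.2 ⟨hp', colBefore_refl p'⟩)
      exact hne (colBefore_antisymm hb (mem_filter.1 this).2)
  intro p hp p' hp' heq
  by_contra hne
  rcases colBefore_total (lam := lam) p p' with h | h
  · exact (key p hp p' hp' h hne).ne heq
  · exact (key p' hp' p hp h (Ne.symm hne)).ne heq.symm

theorem colAt_posIn {p : Fin (r+1) × ℕ} (hp : p ∈ columnPairs lam univ) :
    colAt lam univ (posIn lam univ p.1 p.2) = p := by
  have h : ∃ p' ∈ columnPairs lam univ, posIn lam univ p'.1 p'.2 = posIn lam univ p.1 p.2 :=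
    ⟨p, hp, rfl⟩
  rw [colAt, dif_pos h]
  exact posIn_injOn h.choose_spec.1 hp h.choose_spec.2

theorem card_columnPairs_filter (hlam : ∀ b, IsPartitionFun (lam b)) (B : Finset (Fin (r+1)))
    {j : ℕ} (hj : 1 ≤ j) :
    ((columnPairs lam univ).filter fun p => p.2 ≤ lam p.1 j ∧ p.1 ∈ B).card = lamB lam B j := by
  rw [card_eq_sum_card_fiberwise (f := Prod.fst) (t := B) fun p hp => (mem_filter.1 hp).2.2]
  refine sum_congr rfl fun b hb => ?_
  have : (((columnPairs lam univ).filter fun p => p.2 ≤ lam p.1 j ∧ p.1 ∈ B).filter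
      fun p => p.1 = b) = (Icc 1 (lam b j)).image (fun i => (b, i)) := by
    ext p
    simp only [mem_filter, mem_columnPairs_univ, mem_image, mem_Icc]
    constructor
    · rintro ⟨⟨h1, h2, h3⟩, rfl⟩
      exact ⟨p.2, ⟨h1.1, h2⟩, rfl⟩
    · rintro ⟨i, hi, rfl⟩
      exact ⟨⟨⟨hi.1, hi.2.trans ((hlam b).1 hj)⟩, hi.2, hb⟩, rfl⟩
  rw [this, card_image_of_injective _ fun i i' h => (Prod.mk.inj h).2, Nat.card_Icc,
    Nat.add_sub_cancel]

theorem posIn_image (hlam : ∀ b, IsPartitionFun (lam b)) {j : ℕ} (hj : 1 ≤ j) :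
    ((columnPairs lam univ).filter fun p => p.2 ≤ lam p.1 j).image
      (fun p => posIn lam univ p.1 p.2) = Icc 1 (lamB lam univ j) := by
  have hcard := card_columnPairs_filter hlam univ hj
  simp only [mem_univ, and_true] at hcard
  refine eq_of_subset_of_card_le ?_ ?_
  · intro x hx
    obtain ⟨p, hp, rfl⟩ := mem_image.1 hx
    obtain ⟨hpc, hpj⟩ := mem_filter.1 hp
    have hp1 := (mem_columnPairs_univ.1 hpc).1
    refine mem_Icc.2 ⟨card_pos.2 ⟨p, mem_filter.2 ⟨hpc, colBefore_refl p⟩⟩, ?_⟩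
    rw [← hcard]
    refine card_le_card fun p' hp' => ?_
    obtain ⟨hpc', hb⟩ := mem_filter.1 hp'
    refine mem_filter.2 ⟨hpc', ?_⟩
    have h1 := ((hlam p.1).le_colLen hp1 hj).2 hpj
    have h2 : colLen (lam p.1) p.2 ≤ colLen (lam p'.1) p'.2 := by
      rcases hb with h | ⟨h, -⟩
      · exact h.le
      · exact h.ge
    exact ((hlam p'.1).le_colLen (mem_columnPairs_univ.1 hpc').1 hj).1 (h1.trans h2)
  · rw [card_image_of_injOn (posIn_injOn.mono fun p hp => (mem_filter.1 hp).1), hcard,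
      Nat.card_Icc, Nat.add_sub_cancel]

/-- Among the first `λ^{[r]}_j` columns, exactly `λ^B_j` have their color in `B`. -/
theorem card_colColor_mem (hlam : ∀ b, IsPartitionFun (lam b)) (B : Finset (Fin (r+1)))
    {j : ℕ} (hj : 1 ≤ j) :
    ((Icc 1 (lamB lam univ j)).filter fun x => colColor lam x ∈ B).card = lamB lam B j := by
  rw [← card_columnPairs_filter hlam B hj, ← posIn_image hlam hj, filter_image, filter_filter]
  rw [card_image_of_injOn (posIn_injOn.mono fun p hp => (mem_filter.1 hp).1)]
  congr 1
  refine filter_congr fun p hp => ?_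
  rw [colColor, colAt_posIn hp]

end Coloring

/-! ### Ranks of the selected columns -/

/-- The number of `y ∈ {1, …, x}` satisfying `P`. -/
def rankAmong (P : ℕ → Prop) (x : ℕ) : ℕ := ((Icc 1 x).filter P).card

section Rank

variable {P : ℕ → Prop} {a : ℕ}

theorem rankAmong_mono {x y : ℕ} (h : x ≤ y) : rankAmong P x ≤ rankAmong P y :=
  card_le_card (filter_subset_filter _ (Icc_subset_Icc_right h))

theorem rankAmong_lt {x y : ℕ} (h : x < y) (hy : P y) : rankAmong P x < rankAmong P y := by
  refine card_lt_card ⟨filter_subset_filter _ (Icc_subset_Icc_right h.le), fun hsub => ?_⟩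
  have := hsub (mem_filter.2 ⟨mem_Icc.2 ⟨by omega, le_rfl⟩, hy⟩)
  have := (mem_Icc.1 (mem_filter.1 this).1).2
  omega

theorem rankAmong_lt_iff {x y : ℕ} (hy : P y) :
    rankAmong P x < rankAmong P y ↔ x < y := by
  refine ⟨fun h => ?_, fun h => rankAmong_lt h hy⟩
  by_contra! hle
  exact h.not_ge (rankAmong_mono hle)

theorem rankAmong_inj {x y : ℕ} (hx : P x) (hy : P y) (h : rankAmong P x = rankAmong P y) :
    x = y := by
  rcases lt_trichotomy x y with h' | h' | h'
  · exact absurd h (rankAmong_lt h' hy).ne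
  · exact h'
  · exact absurd h.symm (rankAmong_lt h' hx).ne

theorem one_le_rankAmong {x : ℕ} (hx : 1 ≤ x) (hP : P x) : 1 ≤ rankAmong P x :=
  card_pos.2 ⟨x, mem_filter.2 ⟨mem_Icc.2 ⟨hx, le_rfl⟩, hP⟩⟩

theorem rankAmong_le_iff {x : ℕ} (hP : P x) : rankAmong P x ≤ rankAmong P a ↔ x ≤ a := by
  refine ⟨fun h => ?_, rankAmong_mono⟩
  by_contra! hlt
  exact (rankAmong_lt hlt hP).not_ge h

theorem exists_rankAmong_eq {y : ℕ} (h1 : 1 ≤ y) (h2 : y ≤ rankAmong P a) :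
    ∃ x, 1 ≤ x ∧ x ≤ a ∧ P x ∧ rankAmong P x = y := by
  have : ((Icc 1 a).filter P).image (rankAmong P) = Icc 1 (rankAmong P a) := by
    refine eq_of_subset_of_card_le ?_ ?_
    · intro z hz
      obtain ⟨x, hx, rfl⟩ := mem_image.1 hz
      simp only [mem_filter, mem_Icc] at hx
      exact mem_Icc.2 ⟨one_le_rankAmong hx.1.1 hx.2, rankAmong_mono hx.1.2⟩
    · rw [card_image_of_injOn, Nat.card_Icc, Nat.add_sub_cancel, rankAmong]
      intro x hx x' hx' h
      exact rankAmong_inj (mem_filter.1 hx).2 (mem_filter.1 hx').2 h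
  obtain ⟨x, hx, rfl⟩ := mem_image.1 (this ▸ mem_Icc.2 ⟨h1, h2⟩)
  simp only [mem_filter, mem_Icc] at hx
  exact ⟨x, hx.1.1, hx.1.2, hx.2, rfl⟩

end Rank

/-! ### Fillings of sets of boxes -/

section FillOn

variable {α : Type*} [DecidableEq α]

/-- Fillings of `S` with entries in `{1, …, N}`, extended by zero. -/
def fillOn (S : Finset α) (N : ℕ) : Finset (α → ℕ) :=
  (S.pi fun _ => Icc 1 N).image fun g c => if h : c ∈ S then g c h else 0

theorem mem_fillOn {S : Finset α} {N : ℕ} {τ : α → ℕ} :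
    τ ∈ fillOn S N ↔ (∀ c ∈ S, τ c ∈ Icc 1 N) ∧ ∀ c, c ∉ S → τ c = 0 := by
  simp only [fillOn, mem_image, mem_pi]
  constructor
  · rintro ⟨g, hg, rfl⟩
    exact ⟨fun c hc => by simpa [hc] using hg c hc, fun c hc => by simp [hc]⟩
  · rintro ⟨h1, h2⟩
    refine ⟨fun c _ => τ c, fun c hc => h1 c hc, ?_⟩
    ext c
    by_cases hc : c ∈ S
    · simp [hc]
    · simp [hc, h2 c hc]

/-- Replace the values outside `S` by zero. -/
def zeroOutside (S : Finset α) (τ : α → ℕ) (c : α) : ℕ := if c ∈ S then τ c else 0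

theorem zeroOutside_of_mem {S : Finset α} {τ : α → ℕ} {c : α} (h : c ∈ S) :
    zeroOutside S τ c = τ c := if_pos h

theorem zeroOutside_of_notMem {S : Finset α} {τ : α → ℕ} {c : α} (h : c ∉ S) :
    zeroOutside S τ c = 0 := if_neg h

theorem zeroOutside_mem {S T : Finset α} {N : ℕ} {τ : α → ℕ} (hST : S ⊆ T)
    (hτ : τ ∈ fillOn T N) : zeroOutside S τ ∈ fillOn S N := by
  refine mem_fillOn.2 ⟨fun c hc => ?_, fun c hc => zeroOutside_of_notMem hc⟩
  rw [zeroOutside_of_mem hc]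
  exact (mem_fillOn.1 hτ).1 c (hST hc)

theorem zeroOutside_eq_self {S : Finset α} {N : ℕ} {τ : α → ℕ} (hτ : τ ∈ fillOn S N) :
    zeroOutside S τ = τ := by
  ext c
  by_cases hc : c ∈ S
  · exact zeroOutside_of_mem hc
  · rw [zeroOutside_of_notMem hc, (mem_fillOn.1 hτ).2 c hc]

theorem zeroOutside_piecewise_left {S : Finset α} {N : ℕ} {τ ρ : α → ℕ} (hτ : τ ∈ fillOn S N) :
    zeroOutside S (fun c => if c ∈ S then τ c else ρ c) = τ := by
  rw [← zeroOutside_eq_self hτ]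
  ext c
  by_cases hc : c ∈ S <;> simp [zeroOutside, hc]

theorem zeroOutside_piecewise_right {S T : Finset α} {τ ρ : α → ℕ} (hST : Disjoint S T) :
    zeroOutside T (fun c => if c ∈ S then τ c else ρ c) = zeroOutside T ρ := by
  ext c
  by_cases hc : c ∈ T
  · have := disjoint_right.1 hST hc
    simp [zeroOutside, hc, this]
  · simp [zeroOutside, hc]

theorem prod_sum_fillOn {A ι : Type*} [CommSemiring A] (N : ℕ) (π : Finset ι) (S : ι → Finset α)
    (hd : ∀ B ∈ π, ∀ C ∈ π, B ≠ C → Disjoint (S B) (S C)) (f : ι → (α → ℕ) → A) :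
    ∏ B ∈ π, ∑ τ ∈ fillOn (S B) N, f B τ =
      ∑ τ ∈ fillOn (π.biUnion S) N, ∏ B ∈ π, f B (zeroOutside (S B) τ) := by
  induction π using Finset.induction_on with
  | empty =>
    have : fillOn (∅ : Finset α) N = {fun _ => 0} := by
      ext τ
      simp [mem_fillOn, funext_iff]
    simp [this]
  | insert B π hB ih =>
    have hdB : ∀ C ∈ π, Disjoint (S B) (S C) := fun C hC =>
      hd B (mem_insert_self _ _) C (mem_insert_of_mem hC) fun h => hB (h ▸ hC)
    have hdis : Disjoint (S B) (π.biUnion S) := (disjoint_biUnion_right _ _ _).2 hdB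
    rw [prod_insert hB, ih fun C hC D hD => hd C (mem_insert_of_mem hC) D (mem_insert_of_mem hD),
      sum_mul_sum, ← sum_product', biUnion_insert]
    refine sum_nbij' (fun x c => if c ∈ S B then x.1 c else x.2 c)
      (fun τ => (zeroOutside (S B) τ, zeroOutside (π.biUnion S) τ)) ?_ ?_ ?_ ?_ ?_
    · rintro ⟨τ, ρ⟩ h
      obtain ⟨hτ, hρ⟩ := mem_product.1 h
      refine mem_fillOn.2 ⟨fun c hc => ?_, fun c hc => ?_⟩
      · by_cases hcB : c ∈ S B
        · simpa [hcB] using (mem_fillOn.1 hτ).1 c hcB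
        · have := (mem_fillOn.1 hρ).1 c ((mem_union.1 hc).resolve_left hcB)
          simpa [hcB] using this
      · rw [mem_union, not_or] at hc
        simpa [hc.1] using (mem_fillOn.1 hρ).2 c hc.2
    · intro τ hτ
      exact mem_product.2 ⟨zeroOutside_mem subset_union_left hτ,
        zeroOutside_mem subset_union_right hτ⟩
    · rintro ⟨τ, ρ⟩ h
      obtain ⟨hτ, hρ⟩ := mem_product.1 h
      exact Prod.ext (zeroOutside_piecewise_left hτ)
        ((zeroOutside_piecewise_right hdis).trans (zeroOutside_eq_self hρ))
    · intro τ hτ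
      rw [← zeroOutside_eq_self hτ]
      ext c
      by_cases hc : c ∈ S B <;> by_cases hc' : c ∈ π.biUnion S <;>
        simp only [zeroOutside, mem_union, hc, hc', if_true, if_false, or_true, or_false]
    · rintro ⟨τ, ρ⟩ h
      obtain ⟨hτ, hρ⟩ := mem_product.1 h
      rw [prod_insert hB]
      congr 1
      · exact congrArg (f B) (zeroOutside_piecewise_left hτ).symm
      · refine prod_congr rfl fun C hC => ?_
        exact congrArg (f C) (zeroOutside_piecewise_right (hdB C hC)).symm

theorem sum_fillOn_reindex {A β : Type*} [DecidableEq β] [AddCommMonoid A] (N : ℕ) {S : Finset α}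
    {T : Finset β} (φ : α → β) (hφ : ∀ c ∈ S, φ c ∈ T) (hinj : Set.InjOn φ S)
    (hsurj : ∀ d ∈ T, ∃ c ∈ S, φ c = d)
    (f : (β → ℕ) → A) (g : (α → ℕ) → A)
    (h : ∀ σ ∈ fillOn T N, f σ = g (zeroOutside S fun c => σ (φ c))) :
    ∑ σ ∈ fillOn T N, f σ = ∑ τ ∈ fillOn S N, g τ := by
  refine sum_bij (fun σ _ => zeroOutside S fun c => σ (φ c)) ?_ ?_ ?_ h
  · intro σ hσ
    refine mem_fillOn.2 ⟨fun c hc => ?_, fun c hc => zeroOutside_of_notMem hc⟩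
    rw [zeroOutside_of_mem hc]
    exact (mem_fillOn.1 hσ).1 _ (hφ c hc)
  · intro σ hσ σ' hσ' heq
    ext d
    by_cases hd : d ∈ T
    · obtain ⟨c, hc, rfl⟩ := hsurj d hd
      have := congrFun heq c
      rwa [zeroOutside_of_mem hc, zeroOutside_of_mem hc] at this
    · rw [(mem_fillOn.1 hσ).2 d hd, (mem_fillOn.1 hσ').2 d hd]
  · intro τ hτ
    choose ψ hψ hφψ using hsurj
    refine ⟨fun d => if hd : d ∈ T then τ (ψ d hd) else 0, ?_, ?_⟩
    · refine mem_fillOn.2 ⟨fun d hd => ?_, fun d hd => dif_neg hd⟩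
      rw [dif_pos hd]
      exact (mem_fillOn.1 hτ).1 _ (hψ d hd)
    · ext c
      by_cases hc : c ∈ S
      · rw [zeroOutside_of_mem hc]
        beta_reduce
        rw [dif_pos (hφ c hc), hinj (hψ _ (hφ c hc)) hc (hφψ _ (hφ c hc))]
      · rw [zeroOutside_of_notMem hc, (mem_fillOn.1 hτ).2 c hc]

end FillOn

/-! ### Macdonald polynomials of the diagrams `λ^B` as sums over fillings of part of `λ^{[r]}` -/

theorem fillings_eq_fillOn (f : ℕ → ℕ) (N : ℕ) : fillings f N = fillOn (cells f) N := by
  ext τ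
  simp only [fillings, fillOn, mem_image]

theorem invTriple_congr {σ τ : ℕ × ℕ → ℕ} {c₁ c₂ d₁ d₂ : ℕ × ℕ} (h₁ : σ c₁ = τ d₁)
    (h₂ : σ c₂ = τ d₂) (h₃ : σ (c₁.1, c₁.2 - 1) = τ (d₁.1, d₁.2 - 1)) :
    invTriple σ c₁ c₂ ↔ invTriple τ d₁ d₂ := by
  simp only [invTriple, h₁, h₂, h₃]

/-- The boxes of the diagram of `f` in the columns satisfying `P`. -/
def cellsIn (f : ℕ → ℕ) (P : ℕ → Prop) : Finset (ℕ × ℕ) := (cells f).filter fun c => P c.1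

/-- The inversion pairs of `σ` both of whose columns satisfy `P`. -/
def invPairsIn (f : ℕ → ℕ) (P : ℕ → Prop) (σ : ℕ × ℕ → ℕ) : Finset ((ℕ × ℕ) × (ℕ × ℕ)) :=
  (invPairs f σ).filter fun pr => P pr.1.1 ∧ P pr.2.1

/-- The contribution to `maj(σ)` of the columns satisfying `P`. -/
def majIn (f : ℕ → ℕ) (P : ℕ → Prop) (σ : ℕ × ℕ → ℕ) : ℕ :=
  ∑ c ∈ (desSet f σ).filter (fun c => P c.1), (colLen f c.1 - c.2 + 1)

/-- The monomial attached to the columns of the filling `σ` satisfying `P`. -/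
def weightIn (f : ℕ → ℕ) (P : ℕ → Prop) (σ : ℕ × ℕ → ℕ) : MR :=
  qv ^ (invPairsIn f P σ).card * tv ^ majIn f P σ * ∏ c ∈ cellsIn f P, xv (σ c)

section Restrict

variable {f : ℕ → ℕ} (hf : IsPartitionFun f) {P : ℕ → Prop}
include hf

theorem IsPartitionFun.mem_cellsIn {c : ℕ × ℕ} :
    c ∈ cellsIn f P ↔ (1 ≤ c.1 ∧ 1 ≤ c.2 ∧ c.1 ≤ f c.2) ∧ P c.1 := by
  rw [cellsIn, mem_filter, hf.mem_cells]

theorem IsPartitionFun.below_mem_cellsIn {c : ℕ × ℕ} (hc : c ∈ cellsIn f P) (h2 : 2 ≤ c.2) :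
    (c.1, c.2 - 1) ∈ cellsIn f P := by
  rw [hf.mem_cellsIn] at hc ⊢
  obtain ⟨⟨h1, -, h3⟩, h4⟩ := hc
  exact ⟨⟨h1, by dsimp only; omega, h3.trans (hf.1 (Nat.sub_le _ _))⟩, h4⟩

theorem IsPartitionFun.bottom_notMem_cells {i j : ℕ} (hj : j < 2) : (i, j - 1) ∉ cells f := by
  rw [hf.mem_cells]
  dsimp only
  omega

theorem zeroOutside_cellsIn_below {N : ℕ} {σ : ℕ × ℕ → ℕ} (hσ : σ ∈ fillOn (cells f) N)
    {c : ℕ × ℕ} (hc : c ∈ cellsIn f P) :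
    zeroOutside (cellsIn f P) σ (c.1, c.2 - 1) = σ (c.1, c.2 - 1) := by
  by_cases h2 : 2 ≤ c.2
  · exact zeroOutside_of_mem (hf.below_mem_cellsIn hc h2)
  · have := hf.bottom_notMem_cells (i := c.1) (j := c.2) (by omega)
    rw [(mem_fillOn.1 hσ).2 _ this]
    exact zeroOutside_of_notMem fun h => this (mem_filter.1 h).1

theorem weightIn_zeroOutside {N : ℕ} {σ : ℕ × ℕ → ℕ} (hσ : σ ∈ fillOn (cells f) N) :
    weightIn f P (zeroOutside (cellsIn f P) σ) = weightIn f P σ := by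
  have h1 : invPairsIn f P (zeroOutside (cellsIn f P) σ) = invPairsIn f P σ := by
    ext pr
    simp only [invPairsIn, invPairs, mem_filter, mem_product]
    refine and_congr_left fun hP => and_congr_right fun hc => and_congr_right fun _ =>
      and_congr_right fun _ => ?_
    have hc1 : pr.1 ∈ cellsIn f P := mem_filter.2 ⟨hc.1, hP.1⟩
    exact invTriple_congr (zeroOutside_of_mem hc1)
      (zeroOutside_of_mem (mem_filter.2 ⟨hc.2, hP.2⟩)) (zeroOutside_cellsIn_below hf hσ hc1)
  have h2 : (desSet f (zeroOutside (cellsIn f P) σ)).filter (fun c => P c.1) =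
      (desSet f σ).filter fun c => P c.1 := by
    ext c
    simp only [desSet, mem_filter]
    refine and_congr_left fun hP => and_congr_right fun hc => and_congr_right fun _ => ?_
    have hc1 : c ∈ cellsIn f P := mem_filter.2 ⟨hc, hP⟩
    rw [zeroOutside_of_mem hc1, zeroOutside_cellsIn_below hf hσ hc1]
  rw [weightIn, weightIn, h1, majIn, majIn, h2]
  congr 1
  exact prod_congr rfl fun c hc => by rw [zeroOutside_of_mem hc]

variable {g : ℕ → ℕ} (hg : IsPartitionFun g) (hgf : ∀ j, 1 ≤ j → g j = rankAmong P (f j))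
include hg hgf

theorem rankAmong_mem_cells {c : ℕ × ℕ} (hc : c ∈ cellsIn f P) :
    (rankAmong P c.1, c.2) ∈ cells g := by
  obtain ⟨⟨h1, h2, h3⟩, h4⟩ := hf.mem_cellsIn.1 hc
  refine hg.mem_cells.2 ⟨one_le_rankAmong h1 h4, h2, ?_⟩
  rw [hgf _ h2]
  exact rankAmong_mono h3

theorem exists_rankAmong_cells {d : ℕ × ℕ} (hd : d ∈ cells g) :
    ∃ c ∈ cellsIn f P, (rankAmong P c.1, c.2) = d := by
  obtain ⟨h1, h2, h3⟩ := hg.mem_cells.1 hd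
  rw [hgf _ h2] at h3
  obtain ⟨x, hx1, hx2, hx3, hx4⟩ := exists_rankAmong_eq h1 h3
  exact ⟨(x, d.2), hf.mem_cellsIn.2 ⟨⟨hx1, h2, hx2⟩, hx3⟩, Prod.ext hx4 rfl⟩

omit hf hg hgf in
theorem rankAmong_cells_injOn :
    Set.InjOn (fun c : ℕ × ℕ => (rankAmong P c.1, c.2)) (cellsIn f P) := by
  intro c hc c' hc' h
  obtain ⟨h1, h2⟩ := Prod.mk.inj h
  exact Prod.ext (rankAmong_inj (mem_filter.1 hc).2 (mem_filter.1 hc').2 h1) h2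

theorem colLen_rankAmong {x : ℕ} (hx : 1 ≤ x) (hP : P x) :
    colLen g (rankAmong P x) = colLen f x := by
  have key : ∀ j, 1 ≤ j → (j ≤ colLen g (rankAmong P x) ↔ j ≤ colLen f x) := by
    intro j hj
    rw [hg.le_colLen (one_le_rankAmong hx hP) hj, hf.le_colLen hx hj, hgf j hj,
      rankAmong_le_iff hP]
  have h1 := key (colLen g (rankAmong P x))
  have h2 := key (colLen f x)
  omega

theorem macH_eq_sum_weightIn (N : ℕ) :
    macH g N = ∑ τ ∈ fillOn (cellsIn f P) N, weightIn f P τ := by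
  rw [macH, fillings_eq_fillOn]
  refine sum_fillOn_reindex (A := MR) N (S := cellsIn f P) (T := cells g)
    (fun c : ℕ × ℕ => (rankAmong P c.1, c.2))
    (fun c hc => rankAmong_mem_cells hf hg hgf hc) rankAmong_cells_injOn
    (fun d hd => exists_rankAmong_cells hf hg hgf hd)
    (fun σ => qv ^ invStat g σ * tv ^ majStat g σ * ∏ c ∈ cells g, xv (σ c)) (weightIn f P) ?_
  intro σ hσ
  set τ := zeroOutside (cellsIn f P) fun c => σ (rankAmong P c.1, c.2) with hτ
  have hval : ∀ c ∈ cellsIn f P, τ c = σ (rankAmong P c.1, c.2) := fun c hc =>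
    zeroOutside_of_mem hc
  have hbelow : ∀ c ∈ cellsIn f P, τ (c.1, c.2 - 1) = σ (rankAmong P c.1, c.2 - 1) := by
    intro c hc
    by_cases h2 : 2 ≤ c.2
    · exact hval _ (hf.below_mem_cellsIn hc h2)
    · have h3 := hf.bottom_notMem_cells (i := c.1) (j := c.2) (by omega)
      have h4 := hg.bottom_notMem_cells (i := rankAmong P c.1) (j := c.2) (by omega)
      rw [(mem_fillOn.1 hσ).2 _ h4]
      exact zeroOutside_of_notMem fun h => h3 (mem_filter.1 h).1
  have hinv : invStat g σ = (invPairsIn f P τ).card := by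
    symm
    refine card_bij (fun pr _ => ((rankAmong P pr.1.1, pr.1.2), (rankAmong P pr.2.1, pr.2.2)))
      ?_ ?_ ?_
    · intro pr hpr
      simp only [invPairsIn, invPairs, mem_filter, mem_product] at hpr
      obtain ⟨⟨⟨hc1, hc2⟩, hrow, hlt, htri⟩, hP1, hP2⟩ := hpr
      have hc1' : pr.1 ∈ cellsIn f P := mem_filter.2 ⟨hc1, hP1⟩
      have hc2' : pr.2 ∈ cellsIn f P := mem_filter.2 ⟨hc2, hP2⟩
      simp only [invPairs, mem_filter, mem_product]
      exact ⟨⟨rankAmong_mem_cells hf hg hgf hc1', rankAmong_mem_cells hf hg hgf hc2'⟩, hrow,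
        rankAmong_lt hlt hP2,
        (invTriple_congr (hval _ hc1') (hval _ hc2') (hbelow _ hc1')).1 htri⟩
    · intro pr hpr pr' hpr' h
      simp only [invPairsIn, invPairs, mem_filter, mem_product] at hpr hpr'
      obtain ⟨h1, h2⟩ := Prod.mk.inj h
      exact Prod.ext
        (rankAmong_cells_injOn (mem_filter.2 ⟨hpr.1.1.1, hpr.2.1⟩)
          (mem_filter.2 ⟨hpr'.1.1.1, hpr'.2.1⟩) h1)
        (rankAmong_cells_injOn (mem_filter.2 ⟨hpr.1.1.2, hpr.2.2⟩)
          (mem_filter.2 ⟨hpr'.1.1.2, hpr'.2.2⟩) h2)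
    · rintro ⟨d1, d2⟩ hd
      simp only [invPairs, mem_filter, mem_product] at hd
      obtain ⟨⟨hd1, hd2⟩, hrow, hlt, htri⟩ := hd
      obtain ⟨c1, hc1, rfl⟩ := exists_rankAmong_cells hf hg hgf hd1
      obtain ⟨c2, hc2, rfl⟩ := exists_rankAmong_cells hf hg hgf hd2
      refine ⟨(c1, c2), ?_, rfl⟩
      simp only [invPairsIn, invPairs, mem_filter, mem_product]
      obtain ⟨hc1', hP1⟩ := mem_filter.1 hc1
      obtain ⟨hc2', hP2⟩ := mem_filter.1 hc2
      exact ⟨⟨⟨hc1', hc2'⟩, hrow, (rankAmong_lt_iff hP2).1 hlt,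
        (invTriple_congr (hval _ hc1) (hval _ hc2) (hbelow _ hc1)).2 htri⟩, hP1, hP2⟩
  have hmaj : majStat g σ = majIn f P τ := by
    symm
    refine sum_bij (fun c _ => (rankAmong P c.1, c.2)) ?_ ?_ ?_ ?_
    · intro c hc
      simp only [desSet, mem_filter] at hc ⊢
      obtain ⟨⟨hc, h2, hlt⟩, hP⟩ := hc
      have hc' : c ∈ cellsIn f P := mem_filter.2 ⟨hc, hP⟩
      rw [hval _ hc', hbelow _ hc'] at hlt
      exact ⟨rankAmong_mem_cells hf hg hgf hc', h2, hlt⟩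
    · intro c hc c' hc' h
      simp only [desSet, mem_filter] at hc hc'
      exact rankAmong_cells_injOn (mem_filter.2 ⟨hc.1.1, hc.2⟩)
        (mem_filter.2 ⟨hc'.1.1, hc'.2⟩) h
    · intro d hd
      simp only [desSet, mem_filter] at hd
      obtain ⟨hd, h2, hlt⟩ := hd
      obtain ⟨c, hc, rfl⟩ := exists_rankAmong_cells hf hg hgf hd
      refine ⟨c, ?_, rfl⟩
      simp only [desSet, mem_filter]
      refine ⟨⟨(mem_filter.1 hc).1, h2, ?_⟩, (mem_filter.1 hc).2⟩
      rwa [hval _ hc, hbelow _ hc]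
    · intro c hc
      simp only [desSet, mem_filter] at hc
      rw [colLen_rankAmong hf hg hgf (hf.mem_cells.1 hc.1.1).1 hc.2]
  rw [weightIn, hinv, hmaj]
  congr 1
  symm
  exact prod_bij (fun c _ => (rankAmong P c.1, c.2))
    (fun c hc => rankAmong_mem_cells hf hg hgf hc)
    (fun c hc c' hc' h => rankAmong_cells_injOn hc hc' h)
    (fun d hd => by
      obtain ⟨c, hc, h⟩ := exists_rankAmong_cells hf hg hgf hd
      exact ⟨c, hc, h⟩)
    (fun c hc => by rw [hval c hc])

end Restrict

/-! ### The Macdonald cumulant as a sum over fillings -/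

theorem mem_invPairsIn {f : ℕ → ℕ} {P : ℕ → Prop} {σ : ℕ × ℕ → ℕ}
    {pr : (ℕ × ℕ) × (ℕ × ℕ)} :
    pr ∈ invPairsIn f P σ ↔ pr ∈ invPairs f σ ∧ P pr.1.1 ∧ P pr.2.1 := mem_filter

theorem mem_cellsIn {f : ℕ → ℕ} {P : ℕ → Prop} {c : ℕ × ℕ} :
    c ∈ cellsIn f P ↔ c ∈ cells f ∧ P c.1 := mem_filter

section Cumulant

variable {r : ℕ} {lam : Fin (r + 1) → ℕ → ℕ}

/-- The number of inversion pairs of `σ` both of whose columns have a color in `B`. -/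
def invCount (lam : Fin (r + 1) → ℕ → ℕ) (σ : ℕ × ℕ → ℕ) (B : Finset (Fin (r + 1))) : ℕ :=
  (invPairsIn (lamB lam univ) (fun x => colColor lam x ∈ B) σ).card

theorem eG_comm (σ : ℕ × ℕ → ℕ) (i j : Fin (r + 1)) : eG lam σ i j = eG lam σ j i := by
  simp only [eG, or_comm]

theorem isEdgeCount_invCount (σ : ℕ × ℕ → ℕ) : IsEdgeCount (eG lam σ) (invCount lam σ) := by
  refine ⟨by simp [invCount, invPairsIn], fun v B hv => ?_⟩
  have hsum : ∑ w ∈ B, eG lam σ v w = ((invPairs (lamB lam univ) σ).filter fun pr =>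
      (colColor lam pr.1.1 = v ∧ colColor lam pr.2.1 ∈ B) ∨
        (colColor lam pr.1.1 ∈ B ∧ colColor lam pr.2.1 = v)).card := by
    simp only [eG]
    rw [← card_biUnion]
    · congr 1
      ext pr
      simp only [mem_biUnion, mem_filter]
      constructor
      · rintro ⟨w, hw, h, ⟨h1, rfl⟩ | ⟨rfl, h2⟩⟩
        · exact ⟨h, Or.inl ⟨h1, hw⟩⟩
        · exact ⟨h, Or.inr ⟨hw, h2⟩⟩
      · rintro ⟨h, ⟨h1, h2⟩ | ⟨h1, h2⟩⟩
        · exact ⟨_, h2, h, Or.inl ⟨h1, rfl⟩⟩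
        · exact ⟨_, h1, h, Or.inr ⟨rfl, h2⟩⟩
    · intro w hw w' hw' hne
      refine disjoint_left.2 fun pr h h' => ?_
      have hvw : v ≠ w := fun h => hv (h ▸ hw)
      have hvw' : v ≠ w' := fun h => hv (h ▸ hw')
      rcases (mem_filter.1 h).2 with h | h <;> rcases (mem_filter.1 h').2 with h' | h'
      · exact hne (h.2.symm.trans h'.2)
      · exact hvw (h'.2.symm.trans h.2)
      · exact hvw (h'.1.symm.trans h.1)
      · exact hne (h.1.symm.trans h'.1)
  rw [hsum, eG, invCount, invCount, ← card_union_of_disjoint,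
    ← card_union_of_disjoint]
  · refine congrArg card (Finset.ext fun pr => ?_)
    simp only [mem_union, mem_invPairsIn, mem_filter, mem_insert]
    generalize colColor lam pr.1.1 = a, colColor lam pr.2.1 = b,
      (pr ∈ invPairs (lamB lam univ) σ) = p
    tauto
  · refine disjoint_left.2 fun pr h h' => ?_
    have h1 := (mem_invPairsIn.1 h').2
    rcases mem_union.1 h with h | h
    · rcases (mem_filter.1 h).2 with h | h
      · exact hv (h.1 ▸ h1.1)
      · exact hv (h.1 ▸ h1.1)
    · rcases (mem_filter.1 h).2 with h | h
      · exact hv (h.1 ▸ h1.1)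
      · exact hv (h.2 ▸ h1.2)
  · refine disjoint_left.2 fun pr h h' => ?_
    rcases (mem_filter.1 h').2 with h1 | h1 <;> rcases (mem_filter.1 h).2 with h | h
    · exact hv (h.2 ▸ h1.2)
    · exact hv (h.2 ▸ h1.2)
    · exact hv (h.1 ▸ h1.1)
    · exact hv (h.1 ▸ h1.1)

variable {π : Finset (Finset (Fin (r + 1)))}

theorem IsSetPartition.biUnion_color (hπ : IsSetPartition π univ) {α : Type*} [DecidableEq α]
    {S : Finset α} (col : α → Fin (r + 1)) {T : Finset (Fin (r + 1)) → Finset α}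
    (hT : ∀ B c, c ∈ T B ↔ c ∈ S ∧ col c ∈ B) : π.biUnion T = S := by
  ext c
  simp only [mem_biUnion, hT]
  constructor
  · rintro ⟨B, -, h, -⟩
    exact h
  · intro h
    obtain ⟨B, hB, hc⟩ := hπ.2.2.2 (col c) (mem_univ _)
    exact ⟨B, hB, h, hc⟩

theorem IsSetPartition.disjoint_color (hπ : IsSetPartition π univ) {α : Type*} {S : Finset α}
    (col : α → Fin (r + 1)) {T : Finset (Fin (r + 1)) → Finset α}
    (hT : ∀ B c, c ∈ T B ↔ c ∈ S ∧ col c ∈ B) :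
    ∀ B ∈ π, ∀ C ∈ π, B ≠ C → Disjoint (T B) (T C) := by
  intro B hB C hC hne
  refine disjoint_left.2 fun c h h' => ?_
  exact disjoint_left.1 (hπ.2.2.1 B hB C hC hne) ((hT _ _).1 h).2 ((hT _ _).1 h').2

theorem macH_lamB_eq_sum_weightIn (hlam : ∀ b, IsPartitionFun (lam b)) (N : ℕ)
    (B : Finset (Fin (r + 1))) :
    macH (lamB lam B) N =
      ∑ τ ∈ fillOn (cellsIn (lamB lam univ) fun x => colColor lam x ∈ B) N,
        weightIn (lamB lam univ) (fun x => colColor lam x ∈ B) τ := by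
  refine macH_eq_sum_weightIn (isPartitionFun_lamB hlam univ) (isPartitionFun_lamB hlam B)
    (fun j hj => ?_) N
  rw [← card_colColor_mem hlam B hj, rankAmong]
  congr 1
  ext x
  simp only [mem_filter]

theorem mem_cellsIn_color {f : ℕ → ℕ} {B : Finset (Fin (r + 1))} {c : ℕ × ℕ} :
    c ∈ cellsIn f (fun x => colColor lam x ∈ B) ↔ c ∈ cells f ∧ colColor lam c.1 ∈ B :=
  mem_cellsIn

theorem sum_majIn (hπ : IsSetPartition π univ) (f : ℕ → ℕ) (σ : ℕ × ℕ → ℕ) :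
    ∑ B ∈ π, majIn f (fun x => colColor lam x ∈ B) σ = majStat f σ := by
  have hdes : ∀ (B : Finset (Fin (r + 1))) (c : ℕ × ℕ),
      c ∈ (desSet f σ).filter (fun c => colColor lam c.1 ∈ B) ↔
        c ∈ desSet f σ ∧ colColor lam c.1 ∈ B := fun B c => mem_filter
  rw [majStat, ← hπ.biUnion_color (fun c : ℕ × ℕ => colColor lam c.1) hdes,
    sum_biUnion (hπ.disjoint_color (fun c : ℕ × ℕ => colColor lam c.1) hdes)]
  refine sum_congr rfl fun B _ => ?_
  rw [majIn]
  exact sum_congr (by ext c; simp only [mem_filter]) fun _ _ => rfl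

theorem prod_weightIn (hπ : IsSetPartition π univ) (σ : ℕ × ℕ → ℕ) :
    ∏ B ∈ π, weightIn (lamB lam univ) (fun x => colColor lam x ∈ B) σ =
      (∏ B ∈ π, qv ^ invCount lam σ B) *
        (tv ^ majStat (lamB lam univ) σ * ∏ c ∈ cells (lamB lam univ), xv (σ c)) := by
  simp only [weightIn, prod_mul_distrib, invCount]
  rw [← prod_biUnion
      (hπ.disjoint_color (fun c : ℕ × ℕ => colColor lam c.1) fun B c => mem_cellsIn_color),
    hπ.biUnion_color (fun c : ℕ × ℕ => colColor lam c.1) fun B c => mem_cellsIn_color,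
    prod_pow_eq_pow_sum _ _ tv, sum_majIn hπ, mul_assoc]

theorem prod_macH_lamB (hlam : ∀ b, IsPartitionFun (lam b)) (hπ : IsSetPartition π univ) (N : ℕ) :
    ∏ B ∈ π, macH (lamB lam B) N = ∑ σ ∈ fillings (lamB lam univ) N,
      (∏ B ∈ π, qv ^ invCount lam σ B) *
        (tv ^ majStat (lamB lam univ) σ * ∏ c ∈ cells (lamB lam univ), xv (σ c)) := by
  rw [prod_congr rfl fun B _ => macH_lamB_eq_sum_weightIn hlam N B,
    prod_sum_fillOn N π (fun B => cellsIn (lamB lam univ) fun x => colColor lam x ∈ B)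
      (hπ.disjoint_color (fun c : ℕ × ℕ => colColor lam c.1) fun B c => mem_cellsIn_color),
    hπ.biUnion_color (fun c : ℕ × ℕ => colColor lam c.1) fun B c => mem_cellsIn_color,
    fillings_eq_fillOn]
  refine sum_congr rfl fun σ hσ => ?_
  rw [prod_congr rfl fun B _ => weightIn_zeroOutside (isPartitionFun_lamB hlam univ) hσ,
    prod_weightIn hπ]

theorem macCumulant_eq_sum_fillings (hlam : ∀ b, IsPartitionFun (lam b)) (N : ℕ) :
    macCumulant lam N = (qv - 1) ^ r * ∑ σ ∈ fillings (lamB lam univ) N,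
      Iinv (eG lam σ) qv * tv ^ majStat (lamB lam univ) σ *
        ∏ c ∈ cells (lamB lam univ), xv (σ c) := by
  have h : macCumulant lam N = ∑ σ ∈ fillings (lamB lam univ) N,
      jointCumulant (fun B => qv ^ invCount lam σ B) univ *
        (tv ^ majStat (lamB lam univ) σ * ∏ c ∈ cells (lamB lam univ), xv (σ c)) := by
    simp only [macCumulant, jointCumulant, sum_mul]
    rw [sum_comm]
    refine sum_congr rfl fun π hπ => ?_
    rw [prod_macH_lamB hlam (mem_setPartitions.1 hπ) N, mul_sum]
    exact sum_congr rfl fun σ _ => by ring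
  rw [h, mul_sum]
  refine sum_congr rfl fun σ _ => ?_
  rw [jointCumulant_eq_Iinv (eG_comm σ) (isEdgeCount_invCount σ)]
  ring

end Cumulant

/-! ### Standardization -/

/-- The box `c` precedes the box `c'` in the reading order. -/
def ReadBefore (c c' : ℕ × ℕ) : Prop := c'.2 < c.2 ∨ (c.2 = c'.2 ∧ c.1 < c'.1)

theorem ReadBefore.trans {c c' c'' : ℕ × ℕ} (h : ReadBefore c c') (h' : ReadBefore c' c'') :
    ReadBefore c c'' := by
  unfold ReadBefore at *
  omega

theorem not_readBefore_self (c : ℕ × ℕ) : ¬ReadBefore c c := by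
  unfold ReadBefore
  omega

theorem ReadBefore.asymm {c c' : ℕ × ℕ} (h : ReadBefore c c') : ¬ReadBefore c' c := fun h' =>
  not_readBefore_self c (h.trans h')

theorem readBefore_trichotomy (c c' : ℕ × ℕ) : ReadBefore c c' ∨ c = c' ∨ ReadBefore c' c := by
  unfold ReadBefore
  rw [Prod.ext_iff]
  omega

/-- The fillings `σ` and `τ` of `S` are comparable in the same way along the reading order. -/
def SameOrder (S : Finset (ℕ × ℕ)) (σ τ : ℕ × ℕ → ℕ) : Prop :=
  ∀ c ∈ S, ∀ c' ∈ S, ReadBefore c c' → (σ c ≤ σ c' ↔ τ c ≤ τ c')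

section SameOrder

variable {f : ℕ → ℕ} {N M : ℕ} {σ τ : ℕ × ℕ → ℕ}

theorem SameOrder.invTriple_iff (h : SameOrder (cells f) σ τ) (hσ : σ ∈ fillings f N)
    (hτ : τ ∈ fillings f M) {c₁ c₂ : ℕ × ℕ} (h₁ : c₁ ∈ cells f) (h₂ : c₂ ∈ cells f)
    (hrow : c₁.2 = c₂.2) (hlt : c₁.1 < c₂.1) : invTriple σ c₁ c₂ ↔ invTriple τ c₁ c₂ := by
  rw [fillings_eq_fillOn, mem_fillOn] at hσ hτ
  have p1 := (mem_Icc.1 (hσ.1 _ h₁)).1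
  have p2 := (mem_Icc.1 (hσ.1 _ h₂)).1
  have p1' := (mem_Icc.1 (hτ.1 _ h₁)).1
  have p2' := (mem_Icc.1 (hτ.1 _ h₂)).1
  have h12 := h _ h₁ _ h₂ (Or.inr ⟨hrow, hlt⟩)
  unfold invTriple
  by_cases hb : (c₁.1, c₁.2 - 1) ∈ cells f
  · have hpos : 1 ≤ c₁.2 - 1 := (mem_Icc.1 (mem_product.1 (mem_filter.1 hb).1).2).1
    have h13 := h _ h₁ _ hb (Or.inl (by dsimp only; omega))
    have h23 := h _ h₂ _ hb (Or.inl (by dsimp only; omega))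
    omega
  · have z := hσ.2 _ hb
    have z' := hτ.2 _ hb
    omega

theorem SameOrder.invPairs_eq (h : SameOrder (cells f) σ τ) (hσ : σ ∈ fillings f N)
    (hτ : τ ∈ fillings f M) : invPairs f σ = invPairs f τ := by
  ext pr
  simp only [invPairs, mem_filter, mem_product]
  exact and_congr_right fun hc => and_congr_right fun hrow => and_congr_right fun hlt =>
    h.invTriple_iff hσ hτ hc.1 hc.2 hrow hlt

theorem SameOrder.desSet_eq (h : SameOrder (cells f) σ τ) (hσ : σ ∈ fillings f N)
    (hτ : τ ∈ fillings f M) : desSet f σ = desSet f τ := by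
  rw [fillings_eq_fillOn, mem_fillOn] at hσ hτ
  ext c
  simp only [desSet, mem_filter]
  refine and_congr_right fun hc => and_congr_right fun h2 => ?_
  by_cases hb : (c.1, c.2 - 1) ∈ cells f
  · have := h _ hc _ hb (Or.inl (by dsimp only; omega))
    omega
  · have p := (mem_Icc.1 (hσ.1 _ hc)).1
    have p' := (mem_Icc.1 (hτ.1 _ hc)).1
    have z := hσ.2 _ hb
    have z' := hτ.2 _ hb
    omega

end SameOrder

section Standard

variable {f : ℕ → ℕ} {σ : ℕ × ℕ → ℕ}

theorem mem_standardFillings : σ ∈ standardFillings f ↔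
    σ ∈ fillings f (cells f).card ∧ Set.InjOn σ (cells f) := mem_filter

theorem image_standardFilling (hσ : σ ∈ standardFillings f) :
    (cells f).image σ = Icc 1 (cells f).card := by
  obtain ⟨h1, h2⟩ := mem_standardFillings.1 hσ
  rw [fillings_eq_fillOn, mem_fillOn] at h1
  refine eq_of_subset_of_card_le (image_subset_iff.2 h1.1) ?_
  rw [card_image_of_injOn h2, Nat.card_Icc, Nat.add_sub_cancel]

theorem standardFilling_eq_card (hσ : σ ∈ standardFillings f) {c : ℕ × ℕ} (hc : c ∈ cells f) :
    σ c = ((cells f).filter fun c' => σ c' ≤ σ c).card := by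
  have hinj := (mem_standardFillings.1 hσ).2
  have himg := image_standardFilling hσ
  have h : ((cells f).filter fun c' => σ c' ≤ σ c).image σ = Icc 1 (σ c) := by
    ext k
    have hk : k ∈ (cells f).image σ ↔ k ∈ Icc 1 (cells f).card := by rw [himg]
    have hcm : σ c ∈ Icc 1 (cells f).card := himg ▸ mem_image_of_mem σ hc
    simp only [mem_image, mem_filter, mem_Icc] at hk hcm ⊢
    constructor
    · rintro ⟨d, ⟨hd, hle⟩, rfl⟩
      exact ⟨(hk.1 ⟨d, hd, rfl⟩).1, hle⟩
    · intro h
      obtain ⟨d, hd, rfl⟩ := hk.2 ⟨h.1, h.2.trans hcm.2⟩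
      exact ⟨d, ⟨hd, h.2⟩, rfl⟩
  rw [← card_image_of_injOn (hinj.mono fun d hd => (mem_filter.1 hd).1), h, Nat.card_Icc,
    Nat.add_sub_cancel]

theorem SameOrder.eq_of_standard {σ' τ : ℕ × ℕ → ℕ} (hσ : σ ∈ standardFillings f)
    (hσ' : σ' ∈ standardFillings f) (h : SameOrder (cells f) σ τ)
    (h' : SameOrder (cells f) σ' τ) : σ = σ' := by
  have hle : ∀ c ∈ cells f, ∀ c' ∈ cells f, (σ c ≤ σ c' ↔ σ' c ≤ σ' c') := by
    intro c hc c' hc'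
    have hi := (mem_standardFillings.1 hσ).2.eq_iff hc hc'
    have hi' := (mem_standardFillings.1 hσ').2.eq_iff hc hc'
    rcases readBefore_trichotomy c c' with hr | rfl | hr
    · exact (h c hc c' hc' hr).trans (h' c hc c' hc' hr).symm
    · simp
    · have := (h c' hc' c hc hr).trans (h' c' hc' c hc hr).symm
      have hne : c ≠ c' := fun e => not_readBefore_self c (e ▸ hr)
      simp only [hne, iff_false] at hi hi'
      omega
  ext c
  by_cases hc : c ∈ cells f
  · rw [standardFilling_eq_card hσ hc, standardFilling_eq_card hσ' hc]
    exact congrArg card (filter_congr fun c' hc' => hle c' hc' c hc)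
  · have h1 := (mem_standardFillings.1 hσ).1
    have h2 := (mem_standardFillings.1 hσ').1
    rw [fillings_eq_fillOn, mem_fillOn] at h1 h2
    rw [h1.2 c hc, h2.2 c hc]

/-- The order on boxes defining the standardization of `τ`. -/
def stdLE (τ : ℕ × ℕ → ℕ) (c c' : ℕ × ℕ) : Prop :=
  τ c < τ c' ∨ (τ c = τ c' ∧ ¬ReadBefore c' c)

theorem stdLE_trans {τ : ℕ × ℕ → ℕ} {c c' c'' : ℕ × ℕ} (h : stdLE τ c c') (h' : stdLE τ c' c'') :
    stdLE τ c c'' := by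
  unfold stdLE ReadBefore at *
  omega

theorem stdLE_total (τ : ℕ × ℕ → ℕ) (c c' : ℕ × ℕ) : stdLE τ c c' ∨ stdLE τ c' c := by
  unfold stdLE ReadBefore at *
  omega

theorem stdLE_antisymm {τ : ℕ × ℕ → ℕ} {c c' : ℕ × ℕ} (h : stdLE τ c c') (h' : stdLE τ c' c) :
    c = c' := by
  unfold stdLE ReadBefore at *
  rw [Prod.ext_iff]
  omega

theorem exists_standard_sameOrder (f : ℕ → ℕ) (τ : ℕ × ℕ → ℕ) :
    ∃ σ ∈ standardFillings f, SameOrder (cells f) σ τ := by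
  set σ : ℕ × ℕ → ℕ := zeroOutside (cells f) fun c =>
    ((cells f).filter fun c' => stdLE τ c' c).card with hσ
  have hval : ∀ c ∈ cells f, σ c = ((cells f).filter fun c' => stdLE τ c' c).card := fun c hc =>
    zeroOutside_of_mem hc
  have hself : ∀ c, stdLE τ c c := fun c => (stdLE_total τ c c).elim id id
  have hle : ∀ c ∈ cells f, ∀ c' ∈ cells f, (σ c ≤ σ c' ↔ stdLE τ c c') := by
    intro c hc c' hc'
    rw [hval c hc, hval c' hc']
    constructor
    · intro h
      by_contra hn
      have h' := (stdLE_total τ c c').resolve_left hn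
      refine absurd h (not_le.2 (card_lt_card ⟨fun d hd => ?_, fun hsub => ?_⟩))
      · obtain ⟨hd, hd'⟩ := mem_filter.1 hd
        exact mem_filter.2 ⟨hd, stdLE_trans hd' h'⟩
      · exact hn (mem_filter.1 (hsub (mem_filter.2 ⟨hc, hself c⟩))).2
    · intro h
      refine card_le_card fun d hd => ?_
      obtain ⟨hd, hd'⟩ := mem_filter.1 hd
      exact mem_filter.2 ⟨hd, stdLE_trans hd' h⟩
  refine ⟨σ, mem_standardFillings.2 ⟨?_, ?_⟩, ?_⟩
  · rw [fillings_eq_fillOn, mem_fillOn]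
    refine ⟨fun c hc => ?_, fun c hc => zeroOutside_of_notMem hc⟩
    rw [hval c hc, mem_Icc]
    exact ⟨card_pos.2 ⟨c, mem_filter.2 ⟨hc, hself c⟩⟩, card_filter_le _ _⟩
  · intro c hc c' hc' h
    exact stdLE_antisymm ((hle c hc c' hc').1 h.le) ((hle c' hc' c hc).1 h.ge)
  · intro c hc c' hc' hr
    rw [hle c hc c' hc']
    have := hr.asymm
    simp only [stdLE, this, not_false_eq_true, and_true]
    omega

theorem card_filter_sameOrder (τ : ℕ × ℕ → ℕ) :
    ((standardFillings f).filter fun σ => SameOrder (cells f) σ τ).card = 1 := by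
  obtain ⟨σ, hσ, h⟩ := exists_standard_sameOrder f τ
  refine card_eq_one.2 ⟨σ, ?_⟩
  ext σ'
  simp only [mem_filter, mem_singleton]
  constructor
  · rintro ⟨hσ', h'⟩
    exact h'.eq_of_standard hσ' hσ h
  · rintro rfl
    exact ⟨hσ, h⟩

theorem exists_cell (hσ : σ ∈ standardFillings f) (a : Fin (cells f).card) :
    ∃ c ∈ cells f, σ c = (a : ℕ) + 1 := by
  have : (a : ℕ) + 1 ∈ (cells f).image σ := by
    rw [image_standardFilling hσ, mem_Icc]
    exact ⟨Nat.le_add_left _ _, a.2⟩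
  exact mem_image.1 this

/-- The conditions on `g` in the fundamental quasisymmetric polynomial. -/
def IsFqsIndex {n N : ℕ} (D : Finset ℕ) (g : Fin n → Fin N) : Prop :=
  Monotone g ∧ ∀ a b : Fin n, (b : ℕ) = (a : ℕ) + 1 → (b : ℕ) ∈ D → g a < g b

section Cells

variable {κ : Fin (cells f).card → ℕ × ℕ} (hκ : ∀ a, κ a ∈ cells f)
  (hκσ : ∀ a, σ (κ a) = (a : ℕ) + 1)
include hκ hκσ

theorem IsFqsIndex.lt_of_readBefore {N : ℕ} {g : Fin (cells f).card → Fin N}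
    (hg : IsFqsIndex (iDesSet f σ) g) {a b : Fin (cells f).card} (hab : a < b)
    (hr : ReadBefore (κ b) (κ a)) : g a < g b := by
  suffices H : ∀ m : ℕ, ∀ b : Fin (cells f).card, (b : ℕ) = (a : ℕ) + m + 1 →
      ReadBefore (κ b) (κ a) → g a < g b by
    refine H ((b : ℕ) - (a : ℕ) - 1) b ?_ hr
    have : (a : ℕ) < (b : ℕ) := hab
    omega
  intro m
  induction m with
  | zero =>
    intro b hb hr
    refine hg.2 a b hb (mem_filter.2 ⟨mem_Icc.2 ?_, κ b, hκ b, κ a, hκ a, hκσ b, ?_, hr⟩)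
    · have := b.2
      omega
    · rw [hκσ a, hb]
  | succ m ih =>
    intro b hb hr
    have hb2 := b.2
    set b' : Fin (cells f).card := ⟨(a : ℕ) + m + 1, by omega⟩ with hb'
    have hbb' : (b : ℕ) = (b' : ℕ) + 1 := by rw [hb, hb']; ring
    by_cases hr' : ReadBefore (κ b) (κ b')
    · have h1 : g b' < g b := by
        refine hg.2 b' b hbb' (mem_filter.2 ⟨mem_Icc.2 ?_, κ b, hκ b, κ b', hκ b', hκσ b, ?_, hr'⟩)
        · omega
        · rw [hκσ b', hbb']
      refine (hg.1 ?_).trans_lt h1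
      exact Fin.le_def.2 (by simp only [hb']; omega)
    · have hne : κ b ≠ κ b' := fun h => by
        have := congrArg σ h
        rw [hκσ, hκσ] at this
        omega
      have h1 := ((readBefore_trichotomy (κ b) (κ b')).resolve_left hr').resolve_left hne
      refine (ih b' rfl (h1.trans hr)).trans_le (hg.1 (Fin.le_def.2 (by omega)))

theorem sameOrder_iff_isFqsIndex (hσ : σ ∈ standardFillings f) {N : ℕ}
    {g : Fin (cells f).card → Fin N} {τ : ℕ × ℕ → ℕ} (hg : ∀ a, τ (κ a) = (g a : ℕ) + 1) :
    SameOrder (cells f) σ τ ↔ IsFqsIndex (iDesSet f σ) g := by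
  have hinj := (mem_standardFillings.1 hσ).2
  have hκs : ∀ c ∈ cells f, ∃ a, κ a = c := by
    intro c hc
    have h1 : σ c ∈ Icc 1 (cells f).card := image_standardFilling hσ ▸ mem_image_of_mem σ hc
    rw [mem_Icc] at h1
    refine ⟨⟨σ c - 1, by omega⟩, hinj (hκ _) hc ?_⟩
    rw [hκσ]
    simp only
    omega
  constructor
  · intro h
    refine ⟨fun a b hab => ?_, fun a b hab hb => ?_⟩
    · rcases eq_or_lt_of_le hab with rfl | hlt
      · exact le_rfl
      rw [Fin.lt_def] at hlt
      rw [Fin.le_def]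
      rcases readBefore_trichotomy (κ a) (κ b) with hr | he | hr
      · have := h _ (hκ a) _ (hκ b) hr
        rw [hg, hg, hκσ, hκσ] at this
        omega
      · have := congrArg σ he
        rw [hκσ, hκσ] at this
        omega
      · have := h _ (hκ b) _ (hκ a) hr
        rw [hg, hg, hκσ, hκσ] at this
        omega
    · obtain ⟨-, c, hc, c', hc', h1, h2, hr⟩ := mem_filter.1 hb
      have e1 : c = κ b := hinj hc (hκ b) (by rw [h1, hκσ])
      have e2 : c' = κ a := hinj hc' (hκ a) (by rw [h2, hκσ, hab])
      subst e1 e2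
      have := h _ hc _ hc' hr
      rw [hg, hg, hκσ, hκσ] at this
      rw [Fin.lt_def]
      omega
  · intro h c hc c' hc' hr
    obtain ⟨a, rfl⟩ := hκs c hc
    obtain ⟨b, rfl⟩ := hκs c' hc'
    rw [hg, hg, hκσ, hκσ]
    constructor
    · intro hab
      have := Fin.le_def.1 (h.1 (Fin.le_def.2 (Nat.le_of_succ_le_succ hab)))
      omega
    · intro hab
      by_contra hlt
      have hba : b < a := Fin.lt_def.2 (by omega)
      have := Fin.lt_def.1 (h.lt_of_readBefore hκ hκσ hba hr)
      omega

end Cells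

theorem sum_sameOrder (hσ : σ ∈ standardFillings f) (N : ℕ) :
    ∑ τ ∈ (fillings f N).filter (fun τ => SameOrder (cells f) σ τ), ∏ c ∈ cells f, xv (τ c) =
      Fqs (cells f).card N (iDesSet f σ) := by
  choose κ hκ hκσ using exists_cell hσ
  have hinj := (mem_standardFillings.1 hσ).2
  have hbound : ∀ c ∈ cells f, 1 ≤ σ c ∧ σ c ≤ (cells f).card := fun c hc => by
    rw [← mem_Icc, ← image_standardFilling hσ]
    exact mem_image_of_mem σ hc
  have hκi : ∀ (c) (hc : c ∈ cells f) (h : σ c - 1 < (cells f).card), κ ⟨σ c - 1, h⟩ = c := by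
    intro c hc h
    refine hinj (hκ _) hc ?_
    have := (hbound c hc).1
    rw [hκσ]
    simp only
    omega
  have hmem : ∀ τ ∈ fillings f N, ∀ a, τ (κ a) - 1 < N ∧ 1 ≤ τ (κ a) := by
    intro τ hτ a
    rw [fillings_eq_fillOn, mem_fillOn] at hτ
    have := mem_Icc.1 (hτ.1 _ (hκ a))
    omega
  rw [Fqs]
  symm
  refine sum_bij (fun g _ => fun c => if h : c ∈ cells f then
    (g ⟨σ c - 1, by have := hbound c h; omega⟩ : ℕ) + 1 else 0) ?_ ?_ ?_ ?_
  · intro g hg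
    have hval : ∀ a, (fun c => if h : c ∈ cells f then
        (g ⟨σ c - 1, by have := hbound c h; omega⟩ : ℕ) + 1 else 0) (κ a) = (g a : ℕ) + 1 := by
      intro a
      beta_reduce
      rw [dif_pos (hκ a)]
      congr 3
      exact Fin.ext (by simp only [hκσ, Nat.add_sub_cancel])
    refine mem_filter.2 ⟨?_, (sameOrder_iff_isFqsIndex hκ hκσ hσ hval).2 (mem_filter.1 hg).2⟩
    rw [fillings_eq_fillOn, mem_fillOn]
    refine ⟨fun c hc => ?_, fun c hc => dif_neg hc⟩
    rw [dif_pos hc, mem_Icc]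
    have := (g ⟨σ c - 1, by have := hbound c hc; omega⟩).2
    omega
  · intro g _ g' _ h
    ext a
    have := congrFun h (κ a)
    simp only [dif_pos (hκ a), hκσ, Nat.add_sub_cancel, Fin.eta] at this
    omega
  · intro τ hτ
    obtain ⟨hτ, hs⟩ := mem_filter.1 hτ
    refine ⟨fun a => ⟨τ (κ a) - 1, (hmem τ hτ a).1⟩, mem_filter.2 ⟨mem_univ _, ?_⟩, ?_⟩
    · refine (sameOrder_iff_isFqsIndex hκ hκσ hσ fun a => ?_).1 hs
      have := (hmem τ hτ a).2
      simp only
      omega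
    · ext c
      by_cases hc : c ∈ cells f
      · have h1 := hbound c hc
        have h2 := (hmem τ hτ ⟨σ c - 1, by omega⟩).2
        rw [hκi c hc] at h2
        simp only [dif_pos hc, hκi c hc]
        omega
      · rw [dif_neg hc]
        rw [fillings_eq_fillOn, mem_fillOn] at hτ
        exact (hτ.2 c hc).symm
  · intro g _
    refine prod_bij (fun a _ => κ a) (fun a _ => hκ a) ?_ ?_ ?_
    · intro a _ b _ h
      have := congrArg σ h
      rw [hκσ, hκσ] at this
      exact Fin.ext (by omega)
    · intro c hc
      exact ⟨⟨σ c - 1, by have := hbound c hc; omega⟩, mem_univ _, hκi c hc _⟩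
    · intro a _
      simp only [dif_pos (hκ a), hκσ, Nat.add_sub_cancel, Fin.eta]

/-- Sums over fillings of a function of the standardization, by standard fillings. -/
theorem sum_fillings_eq_sum_standardFillings (f : ℕ → ℕ) (N : ℕ) (Φ : (ℕ × ℕ → ℕ) → MR)
    (hΦ : ∀ σ ∈ standardFillings f, ∀ τ ∈ fillings f N, SameOrder (cells f) σ τ → Φ σ = Φ τ) :
    ∑ τ ∈ fillings f N, Φ τ * ∏ c ∈ cells f, xv (τ c) =
      ∑ σ ∈ standardFillings f, Φ σ * Fqs (cells f).card N (iDesSet f σ) := by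
  have h1 : ∀ τ ∈ fillings f N, Φ τ * ∏ c ∈ cells f, xv (τ c) =
      ∑ σ ∈ (standardFillings f).filter (fun σ => SameOrder (cells f) σ τ),
        Φ σ * ∏ c ∈ cells f, xv (τ c) := by
    intro τ hτ
    rw [sum_congr rfl fun σ hσ =>
      by rw [hΦ σ (mem_filter.1 hσ).1 τ hτ (mem_filter.1 hσ).2], sum_const,
      card_filter_sameOrder, one_smul]
  rw [sum_congr rfl h1]
  simp only [sum_filter]
  rw [sum_comm]
  refine sum_congr rfl fun σ hσ => ?_
  rw [← sum_sameOrder hσ, mul_sum, sum_filter]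

end Standard

/-- **Fundamental quasisymmetric expansion of Macdonald cumulants** (equation (4.3)). -/
theorem stmt14 (r N : ℕ) (hN : 1 ≤ N) (lam : Fin (r+1) → ℕ → ℕ)
    (hlam : ∀ b, IsPartitionFun (lam b)) :
    macCumulant lam N =
      (qv - 1) ^ r *
        ∑ σ ∈ standardFillings (lamB lam univ),
          Iinv (eG lam σ) qv * tv ^ majStat (lamB lam univ) σ *
            Fqs (cells (lamB lam univ)).card N (iDesSet (lamB lam univ) σ) := by
  have hΦ : ∀ σ ∈ standardFillings (lamB lam univ), ∀ τ ∈ fillings (lamB lam univ) N,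
      SameOrder (cells (lamB lam univ)) σ τ →
      Iinv (eG lam σ) qv * tv ^ majStat (lamB lam univ) σ =
        Iinv (eG lam τ) qv * tv ^ majStat (lamB lam univ) τ := by
    intro σ hσ τ hτ h
    have hσ' := (mem_standardFillings.1 hσ).1
    have he : eG lam σ = eG lam τ := by
      ext i j
      simp only [eG, h.invPairs_eq hσ' hτ]
    rw [he, majStat, majStat, h.desSet_eq hσ' hτ]
  rw [macCumulant_eq_sum_fillings hlam N,
    sum_fillings_eq_sum_standardFillings (lamB lam univ) N _ hΦ]

end
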